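/- (Theorem 2: convergence of normalizing constant estimates.) For each n ∈ {1, …, P} and each real p ≥ 1 there exist finite constants C_{1,n} and C_{2,p} such that, for every initialization x_{1:n}^{(0)} ∈ S_1 × ⋯ × S_n and every integer i ≥ 1: E[| Ẑ_1^{(i)} − Z_1 |^p]^{1/p} ≤ B_1 C_{1,1} C_{2,p}/i^{1/2}, and for n ∈ {2, …, P}, E[| R̂_n^{(i)} − Z_n/Z_{n-1} |^p]^{1/p} ≤ B_n C_{1,n} C_{2,p}/i^{1/2}. -/

import Mathlib

open MeasureTheory
open scoped ENNReal

namespace Paper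

noncomputable section

variable {E : Type*} [MeasurableSpace E]

/-- Metropolis–Hastings acceptance probability. -/
def acc {Z : Type*} (w : Z → ℝ≥0∞) (x x' : Z) : ℝ≥0∞ := min 1 (w x' / w x)

/-- The importance weight `w_{m+1}` on `E^{m+1}`. -/
def wgt (γ : (n : ℕ) → (Fin n → E) → ℝ≥0∞) (q : (m : ℕ) → (Fin m → E) → E → ℝ≥0∞)
    (m : ℕ) (x : Fin (m + 1) → E) : ℝ≥0∞ :=
  γ (m + 1) x / (γ m (Fin.init x) * q m (Fin.init x) (x (Fin.last m)))

/-- The importance weight `w_1` on `E^1`. -/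
def wgt1 (γ : (n : ℕ) → (Fin n → E) → ℝ≥0∞) (q1 : E → ℝ≥0∞) (x : Fin 1 → E) : ℝ≥0∞ :=
  γ 1 x / q1 (x 0)

/-- The proposal distribution `μ × q_{m+1}`, viewed as a measure on `E^{m+1}`. -/
def propM (dx : Measure E) (q : (m : ℕ) → (Fin m → E) → E → ℝ≥0∞) (m : ℕ)
    (μ : Measure (Fin m → E)) : Measure (Fin (m + 1) → E) :=
  Measure.map (fun p : (Fin m → E) × E => Fin.snoc p.1 p.2)
    ((μ.prod dx).withDensity fun p => q m p.1 p.2)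

/-- The proposal distribution at level 1, viewed as a measure on `E^1`. -/
def prop1 (dx : Measure E) (q1 : E → ℝ≥0∞) : Measure (Fin 1 → E) :=
  Measure.map (fun y : E => fun _ : Fin 1 => y) (dx.withDensity q1)

/-- The Metropolis–Hastings kernel `K_{m+1, μ}`. -/
def kerM (dx : Measure E) (γ : (n : ℕ) → (Fin n → E) → ℝ≥0∞)
    (q : (m : ℕ) → (Fin m → E) → E → ℝ≥0∞) (m : ℕ) (μ : Measure (Fin m → E))
    (x : Fin (m + 1) → E) : Measure (Fin (m + 1) → E) :=
  (propM dx q m μ).withDensity (acc (wgt γ q m) x) +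
    (1 - ∫⁻ y, acc (wgt γ q m) x y ∂(propM dx q m μ)) • Measure.dirac x

/-- The Metropolis–Hastings kernel `K_1`. -/
def ker1 (dx : Measure E) (γ : (n : ℕ) → (Fin n → E) → ℝ≥0∞) (q1 : E → ℝ≥0∞)
    (x : Fin 1 → E) : Measure (Fin 1 → E) :=
  (prop1 dx q1).withDensity (acc (wgt1 γ q1) x) +
    (1 - ∫⁻ y, acc (wgt1 γ q1) x y ∂(prop1 dx q1)) • Measure.dirac x

/-- The target distribution `π_n` on `E^n`. -/
def tgt (dx : Measure E) [SigmaFinite dx] (γ : (n : ℕ) → (Fin n → E) → ℝ≥0∞)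
    (Z : ℕ → ℝ≥0∞) (n : ℕ) : Measure (Fin n → E) :=
  (Measure.pi fun _ : Fin n => dx).withDensity fun x => γ n x / Z n

/-- The marginal density `π_{m+1}(x_m)`. -/
def marg (dx : Measure E) (γ : (n : ℕ) → (Fin n → E) → ℝ≥0∞) (Z : ℕ → ℝ≥0∞) (m : ℕ)
    (x : Fin m → E) : ℝ≥0∞ :=
  (∫⁻ y, γ (m + 1) (Fin.snoc x y) ∂dx) / Z (m + 1)

/-- The ratio `π_{(m+1)/m}(x_m) = π_{m+1}(x_m)/π_m(x_m)`. -/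
def ratio (dx : Measure E) (γ : (n : ℕ) → (Fin n → E) → ℝ≥0∞) (Z : ℕ → ℝ≥0∞) (m : ℕ)
    (x : Fin m → E) : ℝ≥0∞ :=
  marg dx γ Z m x / (γ m x / Z m)

/-- The invariant distribution `ω_{m+1}(μ)`. -/
def omegaM (dx : Measure E) (γ : (n : ℕ) → (Fin n → E) → ℝ≥0∞) (Z : ℕ → ℝ≥0∞) (m : ℕ)
    (μ : Measure (Fin m → E)) : Measure (Fin (m + 1) → E) :=
  (∫⁻ x, ratio dx γ Z m x ∂μ)⁻¹ •
    Measure.map (fun p : (Fin m → E) × E => Fin.snoc p.1 p.2)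
      ((μ.prod dx).withDensity fun p =>
        ratio dx γ Z m p.1 *
          ((γ (m + 1) (Fin.snoc p.1 p.2) / Z (m + 1)) / marg dx γ Z m p.1))

/-- The empirical measure `π̂_n^{(i)}(ω)`. -/
def emp {Ω : Type*} (X : (n : ℕ) → ℕ → Ω → (Fin n → E)) (n i : ℕ) (ω : Ω) :
    Measure (Fin n → E) :=
  ((i : ℝ≥0∞) + 1)⁻¹ • ∑ k ∈ Finset.range (i + 1), Measure.dirac (X n k ω)

/-- The σ-algebra generated by the variables generated strictly before `X_n^{(i)}`
in the order `X_1^{(1)}, …, X_P^{(1)}, X_1^{(2)}, …` (the variables `X_k^{(0)}`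
being given at initialization). -/
def past {Ω : Type*} (P : ℕ) (X : (n : ℕ) → ℕ → Ω → (Fin n → E)) (n i : ℕ) :
    MeasurableSpace Ω :=
  ⨆ (k : ℕ) (j : ℕ) (_ : (1 ≤ k ∧ k ≤ P ∧ j < i) ∨ (1 ≤ k ∧ k < n ∧ j = i)),
    MeasurableSpace.comap (X k j) inferInstance

/-- The σ-algebra generated by the variables (chain and candidates) generated
strictly before the candidate `X_n^{*(i)}`. -/
def pastStar {Ω : Type*} (P : ℕ) (X Xs : (n : ℕ) → ℕ → Ω → (Fin n → E)) (n i : ℕ) :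
    MeasurableSpace Ω :=
  (⨆ (k : ℕ) (j : ℕ) (_ : (1 ≤ k ∧ k ≤ P ∧ j < i) ∨ (1 ≤ k ∧ k < n ∧ j = i)),
      MeasurableSpace.comap (X k j) inferInstance) ⊔
    ⨆ (k : ℕ) (j : ℕ) (_ : (1 ≤ k ∧ k ≤ P ∧ 1 ≤ j ∧ j < i) ∨ (1 ≤ k ∧ k < n ∧ j = i)),
      MeasurableSpace.comap (Xs k j) inferInstance

/-- If a kernel is a regular conditional distribution of `X` given `𝓕` through an
`𝓕`-measurable variable `ζ`, then `ζ` may be frozen in conditional expectations. -/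
theorem condExp_freeze {Ω S G : Type*} {𝓕 mΩ : MeasurableSpace Ω} [MeasurableSpace S]
    [MeasurableSpace G] (h𝓕 : 𝓕 ≤ mΩ) (μ : Measure Ω) [IsProbabilityMeasure μ]
    (κ : ProbabilityTheory.Kernel S G) [ProbabilityTheory.IsMarkovKernel κ]
    {ζ : Ω → S} (hζ : Measurable[𝓕] ζ) {X : Ω → G} (hX : Measurable X)
    (h : ∀ g : G → ℝ, Measurable g → (∀ z, |g z| ≤ 1) →
      μ[fun ω => g (X ω)|𝓕] =ᵐ[μ] fun ω => ∫ z, g z ∂κ (ζ ω))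
    {H : S × G → ℝ} (hH : Measurable H) {C : ℝ} (hC : ∀ z, |H z| ≤ C) :
    μ[fun ω => H (ζ ω, X ω)|𝓕] =ᵐ[μ] fun ω => ∫ z, H (ζ ω, z) ∂κ (ζ ω) := by
  have hζ' : Measurable ζ := hζ.mono h𝓕 le_rfl
  have hm : StronglyMeasurable fun s => ∫ z, H (s, z) ∂κ s :=
    hH.stronglyMeasurable.integral_kernel_prod_right'
  have hbd : ∀ s, ‖∫ z, H (s, z) ∂κ s‖ ≤ C := fun s => by
    have := norm_integral_le_of_norm_le_const (μ := κ s) (f := fun z => H (s, z)) (C := C)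
      (Filter.Eventually.of_forall fun z => hC _)
    simpa using this
  have hInt : Integrable (fun ω => H (ζ ω, X ω)) μ :=
    Integrable.of_bound (hH.comp (hζ'.prodMk hX)).aestronglyMeasurable C
      (Filter.Eventually.of_forall fun ω => hC _)
  symm
  refine ae_eq_condExp_of_forall_setIntegral_eq h𝓕 hInt (fun A _ _ => ?_) (fun A hA _ => ?_) ?_
  · exact (Integrable.of_bound (hm.measurable.comp hζ').aestronglyMeasurable C
      (Filter.Eventually.of_forall fun ω => hbd _)).integrableOn
  · have hA' : MeasurableSet A := h𝓕 _ hA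
    have key : (μ.restrict A).map (fun ω => (ζ ω, X ω)) =
        Measure.compProd ((μ.restrict A).map ζ) κ := by
      refine Measure.ext_prod fun {s t} hs ht => ?_
      rw [Measure.map_apply (hζ'.prodMk hX) (hs.prod ht), Measure.compProd_apply_prod hs ht,
        setLIntegral_map hs (κ.measurable_coe ht) hζ', Measure.restrict_restrict (hζ' hs)]
      have hB : MeasurableSet[𝓕] (ζ ⁻¹' s ∩ A) := (hζ hs).inter hA
      have e1 := h (t.indicator 1) (measurable_one.indicator ht) (fun z => by
        by_cases hz : z ∈ t <;> simp [hz])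
      have hi : Integrable (fun ω => t.indicator (1 : G → ℝ) (X ω)) μ :=
        Integrable.of_bound ((measurable_one.indicator ht).comp hX).aestronglyMeasurable 1
          (Filter.Eventually.of_forall fun ω => by by_cases hz : X ω ∈ t <;> simp [hz])
      have e2 := setIntegral_condExp h𝓕 hi hB
      rw [setIntegral_congr_ae (g := fun ω => (κ (ζ ω)).real t) (h𝓕 _ hB)
        (e1.mono fun ω hω _ => by rw [hω]; exact integral_indicator_one ht)] at e2
      have e3 : ∫ ω in ζ ⁻¹' s ∩ A, t.indicator (1 : G → ℝ) (X ω) ∂μ =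
          μ.real (X ⁻¹' t ∩ (ζ ⁻¹' s ∩ A)) := by
        have : (fun ω => t.indicator (1 : G → ℝ) (X ω)) = (X ⁻¹' t).indicator 1 := by
          ext ω; simp [Set.indicator, Set.mem_preimage]; rfl
        rw [this, integral_indicator_one (hX ht), measureReal_restrict_apply (hX ht)]
      rw [e3] at e2
      rw [Measure.restrict_apply (hζ'.prodMk hX (hs.prod ht))]
      have e4 : (fun ω => (ζ ω, X ω)) ⁻¹' s ×ˢ t ∩ A = X ⁻¹' t ∩ (ζ ⁻¹' s ∩ A) := by
        ext ω; simp only [Set.mem_inter_iff, Set.mem_preimage, Set.mem_prod]; tauto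
      rw [e4, ← ENNReal.toReal_eq_toReal_iff' (measure_ne_top _ _), ← measureReal_def, ← e2,
        ← integral_toReal]
      · rfl
      · exact ((κ.measurable_coe ht).comp hζ').aemeasurable
      · exact Filter.Eventually.of_forall fun ω => measure_lt_top _ _
      · refine ne_top_of_le_ne_top (b := ∫⁻ ω in ζ ⁻¹' s ∩ A, 1 ∂μ) (by simp) ?_
        exact lintegral_mono fun ω => prob_le_one
    have e5 : ∫ ω in A, H (ζ ω, X ω) ∂μ =
        ∫ z, H z ∂((μ.restrict A).map (fun ω => (ζ ω, X ω))) :=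
      (integral_map (hζ'.prodMk hX).aemeasurable hH.aestronglyMeasurable).symm
    rw [e5, key, Measure.integral_compProd (Integrable.of_bound hH.aestronglyMeasurable C
      (Filter.Eventually.of_forall hC)), integral_map hζ'.aemeasurable hm.aestronglyMeasurable]
  · exact (hm.comp_measurable hζ).aestronglyMeasurable

theorem exp_mul_le_cosh_add_sinh {b t l : ℝ} (hb : 0 < b) (ht : |t| ≤ b) :
    Real.exp (l * t) ≤ Real.cosh (l * b) + t * (Real.sinh (l * b) / b) := by
  obtain ⟨h1, h2⟩ := abs_le.1 ht
  have := convexOn_exp.2 (Set.mem_univ (l * b)) (Set.mem_univ (-(l * b)))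
    
    (show 0 ≤ (b + t) / (2 * b) from div_nonneg (by linarith) (by linarith))
    (show 0 ≤ (b - t) / (2 * b) from div_nonneg (by linarith) (by linarith))
    (by field_simp; ring)
  simp only [smul_eq_mul] at this
  have e : (b + t) / (2 * b) * (l * b) + (b - t) / (2 * b) * (-(l * b)) = l * t := by
    field_simp; ring
  rw [e] at this
  refine this.trans (le_of_eq ?_)
  rw [Real.cosh_eq, Real.sinh_eq]
  field_simp
  ring

/-- The constant in the moment bound for martingales with bounded increments. -/
def momentConst (p : ℝ) : ℝ :=
  ((⌈p⌉₊.factorial : ℝ) * (2 * Real.exp (1 / 2))) ^ (1 / p)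

theorem momentConst_nonneg (p : ℝ) : 0 ≤ momentConst p := by
  unfold momentConst; positivity

theorem rpow_le_factorial_mul_exp {p t : ℝ} (hp : 0 < p) (ht : 0 ≤ t) :
    t ^ p ≤ (⌈p⌉₊.factorial : ℝ) * Real.exp t := by
  have hf : (1 : ℝ) ≤ (⌈p⌉₊.factorial : ℝ) := by exact_mod_cast Nat.factorial_pos _
  rcases le_total t 1 with h | h
  · have h1 : t ^ p ≤ 1 := Real.rpow_le_one ht h hp.le
    have h2 : 1 ≤ Real.exp t := Real.one_le_exp ht
    nlinarith
  · have h1 : t ^ p ≤ t ^ (⌈p⌉₊ : ℝ) := Real.rpow_le_rpow_of_exponent_le h (Nat.le_ceil p)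
    rw [Real.rpow_natCast] at h1
    have h2 := Real.pow_div_factorial_le_exp t ht ⌈p⌉₊
    rw [div_le_iff₀ (by linarith)] at h2
    linarith

section Martingale

variable {Ω : Type*} [mΩ : MeasurableSpace Ω] {μ : Measure Ω} [IsProbabilityMeasure μ]

theorem integral_exp_sum_le {𝓕 : ℕ → MeasurableSpace Ω} (h𝓕 : ∀ k, 𝓕 k ≤ mΩ)
    (hmono : Monotone 𝓕) {D : ℕ → Ω → ℝ} (hD : ∀ k, Measurable[𝓕 (k + 1)] (D k)) {b : ℝ}
    (hb : 0 < b) (hDb : ∀ k, ∀ᵐ ω ∂μ, |D k ω| ≤ b)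
    (hmart : ∀ k, μ[D k|𝓕 k] =ᵐ[μ] 0) (l : ℝ) (n : ℕ) :
    Integrable (fun ω => Real.exp (l * ∑ k ∈ Finset.range n, D k ω)) μ ∧
    ∫ ω, Real.exp (l * ∑ k ∈ Finset.range n, D k ω) ∂μ ≤ Real.cosh (l * b) ^ n := by
  have hS : ∀ n, Measurable[𝓕 n] fun ω => Real.exp (l * ∑ k ∈ Finset.range n, D k ω) := by
    intro n
    refine Real.measurable_exp.comp (Measurable.const_mul ?_ l)
    exact Finset.measurable_sum _ fun k hk =>
      (hD k).mono (hmono (Finset.mem_range.1 hk)) le_rfl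
  have hInt : ∀ n, Integrable (fun ω => Real.exp (l * ∑ k ∈ Finset.range n, D k ω)) μ := by
    intro n
    refine Integrable.of_bound ((hS n).mono (h𝓕 n) le_rfl).aestronglyMeasurable
      (Real.exp (|l| * (n * b))) ?_
    filter_upwards [ae_all_iff.2 hDb] with ω hω
    rw [Real.norm_eq_abs, Real.abs_exp, Real.exp_le_exp]
    refine (le_abs_self _).trans ?_
    rw [abs_mul]
    refine mul_le_mul_of_nonneg_left ((Finset.abs_sum_le_sum_abs _ _).trans ?_) (abs_nonneg _)
    refine (Finset.sum_le_sum fun k _ => hω k).trans ?_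
    simp
  refine ⟨hInt n, ?_⟩
  induction n with
  | zero => simp
  | succ n ih =>
    have hDm : Measurable (D n) := (hD n).mono (h𝓕 _) le_rfl
    have hDi : Integrable (D n) μ := Integrable.of_bound hDm.aestronglyMeasurable b (hDb n)
    set W := fun ω => Real.exp (l * ∑ k ∈ Finset.range n, D k ω) with hW
    have hWD : Integrable (W * D n) μ := (hInt n).mul_bdd hDm.aestronglyMeasurable (hDb n)
    have hzero : ∫ ω, (W * D n) ω ∂μ = 0 := by
      rw [← integral_condExp (h𝓕 n)]
      have := condExp_mul_of_stronglyMeasurable_left (m := 𝓕 n) (hS n).stronglyMeasurable hWD hDi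
      rw [integral_congr_ae (g := fun _ => (0 : ℝ))]
      · simp
      · filter_upwards [this, hmart n] with ω h1 h2
        rw [h1, Pi.mul_apply, h2]; simp
    calc ∫ ω, Real.exp (l * ∑ k ∈ Finset.range (n + 1), D k ω) ∂μ
        ≤ ∫ ω, (Real.cosh (l * b) * W ω + (Real.sinh (l * b) / b) * (W * D n) ω) ∂μ := by
          refine integral_mono_ae (hInt _) (((hInt n).const_mul _).add (hWD.const_mul _)) ?_
          filter_upwards [hDb n] with ω hω
          rw [Finset.sum_range_succ, mul_add, Real.exp_add]
          have := mul_le_mul_of_nonneg_left (exp_mul_le_cosh_add_sinh (l := l) hb hω)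
            (Real.exp_nonneg (l * ∑ k ∈ Finset.range n, D k ω))
          simp only [hW, Pi.mul_apply]
          linarith
      _ = Real.cosh (l * b) * ∫ ω, W ω ∂μ := by
          rw [integral_add ((hInt n).const_mul _) (hWD.const_mul _), integral_const_mul,
            integral_const_mul, hzero, mul_zero, add_zero]
      _ ≤ Real.cosh (l * b) ^ (n + 1) := by
          rw [pow_succ, mul_comm]
          exact mul_le_mul_of_nonneg_right ih (Real.cosh_pos _).le

theorem eLpNorm_martingale_sum_le {𝓕 : ℕ → MeasurableSpace Ω} (h𝓕 : ∀ k, 𝓕 k ≤ mΩ)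
    (hmono : Monotone 𝓕) {D : ℕ → Ω → ℝ} (hD : ∀ k, Measurable[𝓕 (k + 1)] (D k)) {b : ℝ}
    (hb : 0 < b) (hDb : ∀ k, ∀ᵐ ω ∂μ, |D k ω| ≤ b)
    (hmart : ∀ k, μ[D k|𝓕 k] =ᵐ[μ] 0) {p : ℝ} (hp : 1 ≤ p) (n : ℕ) :
    eLpNorm (fun ω => ∑ k ∈ Finset.range n, D k ω) (ENNReal.ofReal p) μ ≤
      ENNReal.ofReal (momentConst p * (b * √n)) := by
  rcases Nat.eq_zero_or_pos n with rfl | hn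
  · simp
  have hp0 : 0 < p := by linarith
  have hsn : 0 < √(n : ℝ) := Real.sqrt_pos.2 (by exact_mod_cast hn)
  set c := b * √(n : ℝ) with hc
  have hc0 : 0 < c := mul_pos hb hsn
  set S := fun ω => ∑ k ∈ Finset.range n, D k ω with hS
  have hSm : Measurable S := Finset.measurable_sum _ fun k _ => (hD k).mono (h𝓕 _) le_rfl
  have hSb : ∀ᵐ ω ∂μ, ‖S ω‖ ≤ n * b := by
    filter_upwards [ae_all_iff.2 hDb] with ω hω
    refine (Finset.abs_sum_le_sum_abs _ _).trans ?_
    refine (Finset.sum_le_sum fun k _ => hω k).trans ?_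
    simp
  have hcosh : ∀ l : ℝ, l ^ 2 * c ^ 2 = 1 → Real.cosh (l * b) ^ n ≤ Real.exp (1 / 2) := by
    intro l hl
    refine (pow_le_pow_left₀ (Real.cosh_pos _).le (Real.cosh_le_exp_half_sq _) n).trans ?_
    rw [← Real.exp_nat_mul, Real.exp_le_exp]
    have : √(n : ℝ) ^ 2 = n := Real.sq_sqrt (by positivity)
    have h2 : l ^ 2 * (b ^ 2 * n) = 1 := by rw [← hl, hc, mul_pow, this]
    nlinarith
  obtain ⟨i1, j1⟩ := integral_exp_sum_le h𝓕 hmono hD hb hDb hmart c⁻¹ n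
  obtain ⟨i2, j2⟩ := integral_exp_sum_le h𝓕 hmono hD hb hDb hmart (-c⁻¹) n
  have k1 := j1.trans (hcosh c⁻¹ (by field_simp))
  have k2 := j2.trans (hcosh (-c⁻¹) (by field_simp))
  have hmem : MemLp S (ENNReal.ofReal p) μ := MemLp.of_bound hSm.aestronglyMeasurable _ hSb
  have hfac : (0 : ℝ) ≤ (⌈p⌉₊.factorial : ℝ) := by positivity
  have hmom : ∫ ω, ‖S ω‖ ^ p ∂μ ≤
      c ^ p * ((⌈p⌉₊.factorial : ℝ) * (2 * Real.exp (1 / 2))) := by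
    have hip : Integrable (fun ω => ‖S ω‖ ^ p) μ := by
      have := hmem.integrable_norm_rpow (by simpa using hp0) ENNReal.ofReal_ne_top
      rwa [ENNReal.toReal_ofReal hp0.le] at this
    calc ∫ ω, ‖S ω‖ ^ p ∂μ
        ≤ ∫ ω, (c ^ p * (⌈p⌉₊.factorial : ℝ)) *
            (Real.exp (c⁻¹ * S ω) + Real.exp (-c⁻¹ * S ω)) ∂μ := by
          refine integral_mono hip ((i1.add i2).const_mul _) fun ω => ?_
          have h1 : ‖S ω‖ = c * |c⁻¹ * S ω| := by
            rw [abs_mul, abs_of_pos (inv_pos.2 hc0), Real.norm_eq_abs]; field_simp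
          have h2 := rpow_le_factorial_mul_exp hp0 (abs_nonneg (c⁻¹ * S ω))
          have h3 : Real.exp |c⁻¹ * S ω| ≤ Real.exp (c⁻¹ * S ω) + Real.exp (-c⁻¹ * S ω) := by
            rcases abs_cases (c⁻¹ * S ω) with ⟨h, _⟩ | ⟨h, _⟩ <;> rw [h]
            · linarith [Real.exp_pos (-c⁻¹ * S ω)]
            · rw [← neg_mul]; linarith [Real.exp_pos (c⁻¹ * S ω)]
          show ‖S ω‖ ^ p ≤ _
          rw [h1, Real.mul_rpow hc0.le (abs_nonneg _), mul_assoc]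
          exact mul_le_mul_of_nonneg_left (h2.trans (mul_le_mul_of_nonneg_left h3 hfac))
            (by positivity)
      _ ≤ _ := by
          rw [integral_const_mul, integral_add i1 i2, mul_assoc]
          refine mul_le_mul_of_nonneg_left (mul_le_mul_of_nonneg_left ?_ hfac) (by positivity)
          linarith
  rw [hmem.eLpNorm_eq_integral_rpow_norm (by simpa using hp0) ENNReal.ofReal_ne_top,
    ENNReal.toReal_ofReal hp0.le]
  refine ENNReal.ofReal_le_ofReal ?_
  refine (Real.rpow_le_rpow (by positivity) hmom (by positivity)).trans (le_of_eq ?_)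
  rw [Real.mul_rpow (by positivity) (by positivity), ← Real.rpow_mul hc0.le,
    mul_inv_cancel₀ hp0.ne', Real.rpow_one, momentConst, one_div p, mul_comm]

end Martingale

section Poisson

open ProbabilityTheory

variable {G : Type*} [MeasurableSpace G]

/-- Acceptance probabilities `a` of an independence Metropolis–Hastings sampler, together with a
rescaled importance weight `v` that bounds them from below. -/
structure IsAcceptance (a : G → G → ℝ) (v : G → ℝ) : Prop where
  measurable_acc : Measurable (Function.uncurry a)
  measurable_weight : Measurable v
  acc_le_one : ∀ x y, a x y ≤ 1
  weight_nonneg : ∀ x, 0 ≤ v x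
  weight_le_acc : ∀ x y, v y ≤ a x y
  symm : ∀ x y, v x * a x y = v y * a y x

/-- The Metropolis–Hastings operator with proposal `ν`. -/
def mhOp (a : G → G → ℝ) (ν : Measure G) (h : G → ℝ) (x : G) : ℝ :=
  ∫ y, (a x y * h y + (1 - a x y) * h x) ∂ν

/-- The part of the Metropolis–Hastings operator left after removing the minorizing measure. -/
def resid (a : G → G → ℝ) (v : G → ℝ) (ν : Measure G) (h : G → ℝ) (x : G) : ℝ :=
  ∫ y, ((a x y - v y) * h y + (1 - a x y) * h x) ∂ν

/-- Truncated Neumann series solving the Poisson equation of the Metropolis–Hastings operator. -/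
def poissonSol (a : G → G → ℝ) (v : G → ℝ) (ν : Measure G) (f : G → ℝ) : ℕ → G → ℝ
  | 0 => fun _ => 0
  | T + 1 => fun x => f x + resid a v ν (poissonSol a v ν f T) x

theorem integrable_of_abs_le {ν : Measure G} [IsFiniteMeasure ν] {h : G → ℝ} (hh : Measurable h)
    {c : ℝ} (hc : ∀ x, |h x| ≤ c) : Integrable h ν :=
  Integrable.of_bound hh.aestronglyMeasurable c (Filter.Eventually.of_forall hc)

theorem abs_integral_le {ν : Measure G} [IsProbabilityMeasure ν] {h : G → ℝ}
    {c : ℝ} (hc : ∀ x, |h x| ≤ c) : |∫ x, h x ∂ν| ≤ c := by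
  have := norm_integral_le_of_norm_le_const (μ := ν) (f := h) (C := c)
    (Filter.Eventually.of_forall hc)
  simpa using this

namespace IsAcceptance

variable {a : G → G → ℝ} {v : G → ℝ} (A : IsAcceptance a v)
include A

theorem acc_nonneg (x y : G) : 0 ≤ a x y := (A.weight_nonneg y).trans (A.weight_le_acc x y)

theorem weight_le_one (x : G) : v x ≤ 1 := (A.weight_le_acc x x).trans (A.acc_le_one x x)

theorem abs_weight_le_one (x : G) : |v x| ≤ 1 :=
  abs_le.2 ⟨by linarith [A.weight_nonneg x], A.weight_le_one x⟩

theorem measurable_section (x : G) : Measurable (a x) :=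
  A.measurable_acc.comp measurable_prodMk_left

theorem abs_weight_mul_le {h : G → ℝ} {c : ℝ} (hc : ∀ x, |h x| ≤ c) (x : G) :
    |v x * h x| ≤ c := by
  rw [abs_mul]
  calc |v x| * |h x| ≤ 1 * |h x| :=
        mul_le_mul_of_nonneg_right (A.abs_weight_le_one x) (abs_nonneg _)
    _ ≤ c := by rw [one_mul]; exact hc x

theorem measurable_residIntegrand {h : G → ℝ} (hh : Measurable h) (x : G) :
    Measurable fun y => (a x y - v y) * h y + (1 - a x y) * h x :=
  (((A.measurable_section x).sub A.measurable_weight).mul hh).add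
    ((measurable_const.sub (A.measurable_section x)).mul measurable_const)

theorem abs_residIntegrand_le {h : G → ℝ} {c : ℝ} (hc : ∀ x, |h x| ≤ c) (x y : G) :
    |(a x y - v y) * h y + (1 - a x y) * h x| ≤ (1 - v y) * c := by
  refine (abs_add_le _ _).trans ?_
  rw [abs_mul, abs_mul, abs_of_nonneg (sub_nonneg.2 (A.weight_le_acc x y)),
    abs_of_nonneg (sub_nonneg.2 (A.acc_le_one x y))]
  have h1 := mul_le_mul_of_nonneg_left (hc y) (sub_nonneg.2 (A.weight_le_acc x y))
  have h2 := mul_le_mul_of_nonneg_left (hc x) (sub_nonneg.2 (A.acc_le_one x y))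
  linarith

theorem abs_residIntegrand_le' {h : G → ℝ} {c : ℝ} (hc : ∀ x, |h x| ≤ c) (x y : G) :
    |(a x y - v y) * h y + (1 - a x y) * h x| ≤ c := by
  have h0 : 0 ≤ c := (abs_nonneg _).trans (hc x)
  refine (A.abs_residIntegrand_le hc x y).trans ?_
  nlinarith [A.weight_nonneg y]

theorem integrable_weight {ν : Measure G} [IsFiniteMeasure ν] : Integrable v ν :=
  integrable_of_abs_le A.measurable_weight A.abs_weight_le_one

theorem integrable_weight_mul {ν : Measure G} [IsFiniteMeasure ν] {h : G → ℝ}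
    (hh : Measurable h) {c : ℝ} (hc : ∀ x, |h x| ≤ c) : Integrable (fun x => v x * h x) ν :=
  integrable_of_abs_le (A.measurable_weight.mul hh) (A.abs_weight_mul_le hc)

theorem integrable_residIntegrand {ν : Measure G} [IsFiniteMeasure ν] {h : G → ℝ}
    (hh : Measurable h) {c : ℝ} (hc : ∀ x, |h x| ≤ c) (x : G) :
    Integrable (fun y => (a x y - v y) * h y + (1 - a x y) * h x) ν :=
  integrable_of_abs_le (A.measurable_residIntegrand hh x) (A.abs_residIntegrand_le' hc x)

theorem measurable_resid {ν : Measure G} [IsProbabilityMeasure ν] {h : G → ℝ}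
    (hh : Measurable h) : Measurable (resid a v ν h) := by
  have : Measurable fun z : G × G => (a z.1 z.2 - v z.2) * h z.2 + (1 - a z.1 z.2) * h z.1 :=
    ((A.measurable_acc.sub (A.measurable_weight.comp measurable_snd)).mul
      (hh.comp measurable_snd)).add
      ((measurable_const.sub A.measurable_acc).mul (hh.comp measurable_fst))
  exact this.stronglyMeasurable.integral_prod_right'.measurable

variable {ν ν' : Measure G} [IsProbabilityMeasure ν] [IsProbabilityMeasure ν']

theorem abs_resid_le {h : G → ℝ} (hh : Measurable h) {c ε : ℝ}
    (hc : ∀ x, |h x| ≤ c) (hε : ε ≤ ∫ y, v y ∂ν) (x : G) : |resid a v ν h x| ≤ (1 - ε) * c := by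
  have h0 : 0 ≤ c := (abs_nonneg _).trans (hc x)
  have hi : Integrable (fun y => (1 - v y) * c) ν :=
    ((integrable_const 1).sub A.integrable_weight).mul_const c
  refine (abs_integral_le_integral_abs).trans ?_
  refine (integral_mono (A.integrable_residIntegrand hh hc x).abs hi
    (A.abs_residIntegrand_le hc x)).trans ?_
  rw [integral_mul_const, integral_sub (integrable_const 1) A.integrable_weight]
  refine mul_le_mul_of_nonneg_right ?_ h0
  simp only [integral_const, probReal_univ, smul_eq_mul, mul_one]
  linarith

theorem resid_sub {h h' : G → ℝ} (hh : Measurable h) (hh' : Measurable h') {c c' : ℝ}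
    (hc : ∀ x, |h x| ≤ c) (hc' : ∀ x, |h' x| ≤ c') (x : G) :
    resid a v ν h x - resid a v ν h' x = resid a v ν (fun y => h y - h' y) x := by
  unfold resid
  rw [← integral_sub (A.integrable_residIntegrand hh hc x) (A.integrable_residIntegrand hh' hc' x)]
  congr 1
  ext y
  ring

theorem mhOp_eq {h : G → ℝ} (hh : Measurable h) {c : ℝ} (hc : ∀ x, |h x| ≤ c) (x : G) :
    mhOp a ν h x = resid a v ν h x + ∫ y, v y * h y ∂ν := by
  unfold mhOp resid
  rw [← integral_add (A.integrable_residIntegrand hh hc x) (A.integrable_weight_mul hh hc)]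
  congr 1
  ext y
  ring

theorem measurable_mhOp {h : G → ℝ} (hh : Measurable h) : Measurable (mhOp a ν h) := by
  have : Measurable fun z : G × G => a z.1 z.2 * h z.2 + (1 - a z.1 z.2) * h z.1 :=
    (A.measurable_acc.mul (hh.comp measurable_snd)).add
      ((measurable_const.sub A.measurable_acc).mul (hh.comp measurable_fst))
  exact this.stronglyMeasurable.integral_prod_right'.measurable

theorem abs_mhIntegrand_le {h : G → ℝ} {c : ℝ} (hc : ∀ x, |h x| ≤ c) (x y : G) :
    |a x y * h y + (1 - a x y) * h x| ≤ c := by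
  refine (abs_add_le _ _).trans ?_
  rw [abs_mul, abs_mul, abs_of_nonneg (A.acc_nonneg x y),
    abs_of_nonneg (sub_nonneg.2 (A.acc_le_one x y))]
  have h1 := mul_le_mul_of_nonneg_left (hc y) (A.acc_nonneg x y)
  have h2 := mul_le_mul_of_nonneg_left (hc x) (sub_nonneg.2 (A.acc_le_one x y))
  linarith

theorem abs_mhOp_le {h : G → ℝ} {c : ℝ} (hc : ∀ x, |h x| ≤ c) (x : G) : |mhOp a ν h x| ≤ c :=
  abs_integral_le (A.abs_mhIntegrand_le hc x)

/-- The measure with density `v` with respect to the proposal is invariant. -/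
theorem integral_weight_mul_mhOp {h : G → ℝ} (hh : Measurable h) {c : ℝ} (hc : ∀ x, |h x| ≤ c) :
    ∫ x, v x * mhOp a ν h x ∂ν = ∫ x, v x * h x ∂ν := by
  have hi : ∀ x, Integrable (fun y => a x y * h y + (1 - a x y) * h x) ν := fun x =>
    integrable_of_abs_le (((A.measurable_section x).mul hh).add
      ((measurable_const.sub (A.measurable_section x)).mul measurable_const))
      (A.abs_mhIntegrand_le hc x)
  have e : ∀ x, v x * mhOp a ν h x - v x * h x = ∫ y, v x * a x y * (h y - h x) ∂ν := by
    intro x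
    have : ∫ y, v x * a x y * (h y - h x) ∂ν =
        ∫ y, (v x * (a x y * h y + (1 - a x y) * h x) - v x * h x) ∂ν := by
      congr 1; ext y; ring
    rw [this, integral_sub ((hi x).const_mul _) (integrable_const _), integral_const_mul]
    simp [mhOp]
  rw [← sub_eq_zero, ← integral_sub (A.integrable_weight_mul (A.measurable_mhOp hh)
    (A.abs_mhOp_le hc)) (A.integrable_weight_mul hh hc)]
  simp_rw [e]
  have hm : Measurable (fun z : G × G => v z.1 * a z.1 z.2 * (h z.2 - h z.1)) :=
    ((A.measurable_weight.comp measurable_fst).mul A.measurable_acc).mul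
      ((hh.comp measurable_snd).sub (hh.comp measurable_fst))
  have hb : ∀ z : G × G, |v z.1 * a z.1 z.2 * (h z.2 - h z.1)| ≤ 2 * c := by
    intro z
    rw [abs_mul, abs_mul]
    have h1 : |h z.2 - h z.1| ≤ 2 * c := (abs_sub _ _).trans (by linarith [hc z.1, hc z.2])
    have h2 : |v z.1| * |a z.1 z.2| ≤ 1 := mul_le_one₀ (A.abs_weight_le_one _) (abs_nonneg _)
      (by rw [abs_of_nonneg (A.acc_nonneg _ _)]; exact A.acc_le_one _ _)
    calc _ ≤ 1 * |h z.2 - h z.1| := mul_le_mul_of_nonneg_right h2 (abs_nonneg _)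
      _ ≤ 2 * c := by rw [one_mul]; exact h1
  have hswap := integral_integral_swap (μ := ν) (ν := ν)
    (f := fun x y => v x * a x y * (h y - h x)) (integrable_of_abs_le hm hb)
  have hneg : ∀ x y, v x * a x y * (h y - h x) = -(v y * a y x * (h x - h y)) := by
    intro x y; rw [A.symm x y]; ring
  have : ∫ x, ∫ y, v x * a x y * (h y - h x) ∂ν ∂ν =
      -∫ y, ∫ x, v x * a x y * (h y - h x) ∂ν ∂ν := by
    simp_rw [← integral_neg]
    congr 1; ext x; congr 1; ext y; rw [hneg x y]
  linarith

variable {f : G → ℝ}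

theorem measurable_poissonSol (hf : Measurable f) (T : ℕ) :
    Measurable (poissonSol a v ν f T) := by
  induction T with
  | zero => exact measurable_const
  | succ T ih => exact hf.add (A.measurable_resid ih)

theorem abs_poissonSol_le_nat (hf : Measurable f) (hf1 : ∀ x, |f x| ≤ 1) (T : ℕ) (x : G) :
    |poissonSol a v ν f T x| ≤ T := by
  induction T generalizing x with
  | zero => simp [poissonSol]
  | succ T ih =>
    have h0 : (0 : ℝ) ≤ ∫ y, v y ∂ν := integral_nonneg A.weight_nonneg
    have := A.abs_resid_le (A.measurable_poissonSol (ν := ν) hf T) ih h0 x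
    refine (abs_add_le _ _).trans ?_
    push_cast
    linarith [hf1 x]

variable {ε : ℝ}

theorem abs_poissonSol_succ_sub_le (hf : Measurable f) (hf1 : ∀ x, |f x| ≤ 1)
    (hε : ε ≤ ∫ y, v y ∂ν) (T : ℕ) (x : G) :
    |poissonSol a v ν f (T + 1) x - poissonSol a v ν f T x| ≤ (1 - ε) ^ T := by
  induction T generalizing x with
  | zero => simpa [poissonSol, resid] using hf1 x
  | succ T ih =>
    have m1 := A.measurable_poissonSol (ν := ν) hf T
    have m2 := A.measurable_poissonSol (ν := ν) hf (T + 1)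
    have e : poissonSol a v ν f (T + 1 + 1) x - poissonSol a v ν f (T + 1) x =
        resid a v ν (fun y => poissonSol a v ν f (T + 1) y - poissonSol a v ν f T y) x := by
      rw [← A.resid_sub m2 m1 (A.abs_poissonSol_le_nat hf hf1 _)
        (A.abs_poissonSol_le_nat hf hf1 _)]
      simp only [poissonSol]; ring
    rw [e, pow_succ, mul_comm]
    exact A.abs_resid_le (m2.sub m1) ih hε x

variable (hε0 : 0 < ε)
include hε0

theorem abs_poissonSol_le (hf : Measurable f) (hf1 : ∀ x, |f x| ≤ 1)
    (hε : ε ≤ ∫ y, v y ∂ν) (T : ℕ) (x : G) : |poissonSol a v ν f T x| ≤ 1 / ε := by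
  induction T generalizing x with
  | zero => simp [poissonSol, hε0.le]
  | succ T ih =>
    have := A.abs_resid_le (A.measurable_poissonSol (ν := ν) hf T) ih hε x
    refine (abs_add_le _ _).trans ?_
    have e : (1 - ε) * (1 / ε) = 1 / ε - 1 := by field_simp
    linarith [hf1 x]

theorem abs_poissonSol_sub_le (hf : Measurable f) (hf1 : ∀ x, |f x| ≤ 1)
    (hε : ε ≤ ∫ y, v y ∂ν) (hε' : ε ≤ ∫ y, v y ∂ν') {τ : ℝ} (hτ : 0 ≤ τ)
    (htv : ∀ g : G → ℝ, Measurable g → (∀ x, |g x| ≤ 1) →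
      |∫ y, g y ∂ν' - ∫ y, g y ∂ν| ≤ τ) (T : ℕ) (x : G) :
    |poissonSol a v ν' f T x - poissonSol a v ν f T x| ≤ τ / ε ^ 2 := by
  induction T generalizing x with
  | zero => simp only [poissonSol, sub_self, abs_zero]; positivity
  | succ T ih =>
    have m1 := A.measurable_poissonSol (ν := ν) hf T
    have m2 := A.measurable_poissonSol (ν := ν') hf T
    have b1 := A.abs_poissonSol_le hε0 hf hf1 hε T
    have b2 := A.abs_poissonSol_le hε0 hf hf1 hε' T
    have e : poissonSol a v ν' f (T + 1) x - poissonSol a v ν f (T + 1) x =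
        resid a v ν' (fun y => poissonSol a v ν' f T y - poissonSol a v ν f T y) x +
        (resid a v ν' (poissonSol a v ν f T) x - resid a v ν (poissonSol a v ν f T) x) := by
      rw [← A.resid_sub m2 m1 b2 b1]
      simp only [poissonSol]; ring
    have h1 := A.abs_resid_le (m2.sub m1) ih hε' x
    have h2 : |resid a v ν' (poissonSol a v ν f T) x - resid a v ν (poissonSol a v ν f T) x|
        ≤ τ / ε := by
      have := htv (fun y => ε * ((a x y - v y) * poissonSol a v ν f T y +
        (1 - a x y) * poissonSol a v ν f T x))
        ((A.measurable_residIntegrand m1 x).const_mul ε) (fun y => by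
          rw [abs_mul, abs_of_pos hε0]
          have := mul_le_mul_of_nonneg_left (A.abs_residIntegrand_le' b1 x y) hε0.le
          rwa [mul_one_div_cancel hε0.ne'] at this)
      rw [integral_const_mul, integral_const_mul, ← mul_sub, abs_mul, abs_of_pos hε0] at this
      rw [le_div_iff₀ hε0, mul_comm]
      exact this
    rw [e]
    refine (abs_add_le _ _).trans ((add_le_add h1 h2).trans (le_of_eq ?_))
    field_simp
    ring

/-- The truncated Neumann series solves the Poisson equation up to a geometric error. -/
theorem abs_poisson_error_le (hf : Measurable f) (hf1 : ∀ x, |f x| ≤ 1)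
    (hε : ε ≤ ∫ y, v y ∂ν) (T : ℕ) (x : G) :
    |f x - (∫ y, v y * f y ∂ν) / (∫ y, v y ∂ν) -
      (poissonSol a v ν f T x - mhOp a ν (poissonSol a v ν f T) x)| ≤ 2 * (1 - ε) ^ T := by
  have m1 := A.measurable_poissonSol (ν := ν) hf T
  have m2 := A.measurable_poissonSol (ν := ν) hf (T + 1)
  have b1 := A.abs_poissonSol_le hε0 hf hf1 hε T
  have b2 := A.abs_poissonSol_le hε0 hf hf1 hε (T + 1)
  have herr := A.abs_poissonSol_succ_sub_le hf hf1 hε T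
  have hV : 0 < ∫ y, v y ∂ν := hε0.trans_le hε
  have hV1 : ∫ y, v y ∂ν ≤ 1 := (le_abs_self _).trans (abs_integral_le A.abs_weight_le_one)
  set h := poissonSol a v ν f T with hh
  set e : G → ℝ := fun x => poissonSol a v ν f (T + 1) x - h x with he
  have hme : Measurable e := m2.sub m1
  have hpt : ∀ x, f x = e x + h x - mhOp a ν h x + ∫ y, v y * h y ∂ν := by
    intro x
    rw [A.mhOp_eq m1 b1]
    simp only [he, poissonSol, ← hh]
    ring
  have hInt : ∫ y, v y * f y ∂ν =
      ∫ y, v y * e y ∂ν + (∫ y, v y ∂ν) * ∫ y, v y * h y ∂ν := by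
    have i1 := A.integrable_weight_mul (ν := ν) hme herr
    have i2 := A.integrable_weight_mul (ν := ν) m1 b1
    have i3 := A.integrable_weight_mul (ν := ν) (A.measurable_mhOp (ν := ν) m1) (A.abs_mhOp_le b1)
    have : (fun y => v y * f y) = fun y => v y * e y + v y * h y - v y * mhOp a ν h y +
        v y * ∫ y, v y * h y ∂ν := by
      ext y; rw [hpt y]; ring
    have i12 : Integrable (fun y => v y * e y + v y * h y) ν := i1.add i2
    have i123 : Integrable (fun y => v y * e y + v y * h y - v y * mhOp a ν h y) ν := i12.sub i3
    rw [this, integral_add i123 (A.integrable_weight.mul_const _), integral_sub i12 i3,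
      integral_add i1 i2, A.integral_weight_mul_mhOp m1 b1,
      integral_mul_const]
    ring
  have hve : |(∫ y, v y * e y ∂ν) / (∫ y, v y ∂ν)| ≤ (1 - ε) ^ T := by
    rw [abs_div, abs_of_pos hV, div_le_iff₀ hV]
    refine (abs_integral_le_integral_abs).trans ?_
    rw [mul_comm, ← integral_mul_const]
    refine integral_mono (A.integrable_weight_mul (ν := ν) hme herr).abs
      (A.integrable_weight.mul_const _) fun y => ?_
    simp only [abs_mul, abs_of_nonneg (A.weight_nonneg y)]
    exact mul_le_mul_of_nonneg_left (herr y) (A.weight_nonneg y)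
  have : f x - (∫ y, v y * f y ∂ν) / (∫ y, v y ∂ν) - (h x - mhOp a ν h x) =
      e x - (∫ y, v y * e y ∂ν) / (∫ y, v y ∂ν) := by
    rw [hInt, hpt x]
    field_simp
    ring
  rw [this]
  refine (abs_sub _ _).trans ?_
  linarith [herr x]

end IsAcceptance

end Poisson

section AdaptiveChain

open ProbabilityTheory

/-- Probability measures on `G`, as a measurable space. -/
abbrev ProbMeas (G : Type*) [MeasurableSpace G] : Type _ :=
  {ν : Measure G // IsProbabilityMeasure ν}

variable {G : Type*} [MeasurableSpace G]

instance (ν : ProbMeas G) : IsProbabilityMeasure ν.1 := ν.2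

/-- The kernel sending a probability measure to itself. -/
def evalKernel (G : Type*) [MeasurableSpace G] : Kernel (ProbMeas G) G :=
  ⟨Subtype.val, measurable_subtype_coe⟩

instance : IsMarkovKernel (evalKernel G) := ⟨fun ν => ν.2⟩

theorem measurable_integral_probMeas {S : Type*} [MeasurableSpace S] {N : S → ProbMeas G}
    (hN : Measurable N) {H : S × G → ℝ} (hH : Measurable H) :
    Measurable fun s => ∫ y, H (s, y) ∂(N s).1 :=
  (hH.stronglyMeasurable.integral_kernel_prod_right'
    (κ := (evalKernel G).comap N hN)).measurable

theorem measurable_poissonSol_uncurry {a : G → G → ℝ} {v : G → ℝ} (A : IsAcceptance a v)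
    {f : G → ℝ} (hf : Measurable f) (T : ℕ) :
    Measurable fun z : ProbMeas G × G => poissonSol a v z.1.1 f T z.2 := by
  induction T with
  | zero => exact measurable_const
  | succ T ih =>
    refine (hf.comp measurable_snd).add ?_
    refine measurable_integral_probMeas (N := fun z : ProbMeas G × G => z.1) measurable_fst
      (H := fun z => (a z.1.2 z.2 - v z.2) * poissonSol a v z.1.1.1 f T z.2 +
        (1 - a z.1.2 z.2) * poissonSol a v z.1.1.1 f T z.1.2) ?_
    have ha : Measurable fun z : (ProbMeas G × G) × G => a z.1.2 z.2 :=
      A.measurable_acc.comp ((measurable_snd.comp measurable_fst).prodMk measurable_snd)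
    have h1 : Measurable fun z : (ProbMeas G × G) × G => poissonSol a v z.1.1.1 f T z.2 :=
      ih.comp ((measurable_fst.comp measurable_fst).prodMk measurable_snd)
    have h2 : Measurable fun z : (ProbMeas G × G) × G => poissonSol a v z.1.1.1 f T z.1.2 :=
      ih.comp measurable_fst
    exact ((ha.sub (A.measurable_weight.comp measurable_snd)).mul h1).add
      ((measurable_const.sub ha).mul h2)

/-- The law of the new state given the current state, the candidate and the randomness of the
proposal. -/
def moveKernel {a : G → G → ℝ} {v : G → ℝ} (A : IsAcceptance a v) :
    Kernel (ProbMeas G × G × G) G where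
  toFun z := ENNReal.ofReal (a z.2.1 z.2.2) • Measure.dirac z.2.2 +
    ENNReal.ofReal (1 - a z.2.1 z.2.2) • Measure.dirac z.2.1
  measurable' := by
    refine Measure.measurable_of_measurable_coe _ fun s hs => ?_
    have ha : Measurable fun z : ProbMeas G × G × G => a z.2.1 z.2.2 :=
      A.measurable_acc.comp measurable_snd
    simp only [Measure.coe_add, Measure.coe_smul, Pi.add_apply, Pi.smul_apply, smul_eq_mul,
      Measure.dirac_apply' _ hs]
    exact (ha.ennreal_ofReal.mul ((measurable_one.indicator hs).comp
      (measurable_snd.comp measurable_snd))).add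
      ((measurable_const.sub ha).ennreal_ofReal.mul ((measurable_one.indicator hs).comp
      (measurable_fst.comp measurable_snd)))

theorem integral_moveKernel {a : G → G → ℝ} {v : G → ℝ} (A : IsAcceptance a v)
    (z : ProbMeas G × G × G) {g : G → ℝ} (hg : Measurable g) {c : ℝ} (hc : ∀ x, |g x| ≤ c) :
    ∫ x, g x ∂moveKernel A z = a z.2.1 z.2.2 * g z.2.2 + (1 - a z.2.1 z.2.2) * g z.2.1 := by
  show ∫ x, g x ∂(ENNReal.ofReal (a z.2.1 z.2.2) • Measure.dirac z.2.2 +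
    ENNReal.ofReal (1 - a z.2.1 z.2.2) • Measure.dirac z.2.1) = _
  rw [integral_add_measure
    ((integrable_of_abs_le hg hc).smul_measure ENNReal.ofReal_ne_top)
    ((integrable_of_abs_le hg hc).smul_measure ENNReal.ofReal_ne_top),
    integral_smul_measure, integral_smul_measure, integral_dirac' _ _ hg.stronglyMeasurable,
    integral_dirac' _ _ hg.stronglyMeasurable, ENNReal.toReal_ofReal (A.acc_nonneg _ _),
    ENNReal.toReal_ofReal (sub_nonneg.2 (A.acc_le_one _ _)), smul_eq_mul, smul_eq_mul]

instance {a : G → G → ℝ} {v : G → ℝ} (A : IsAcceptance a v) : IsMarkovKernel (moveKernel A) := by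
  refine ⟨fun z => ⟨?_⟩⟩
  show (ENNReal.ofReal (a z.2.1 z.2.2) • Measure.dirac z.2.2 +
    ENNReal.ofReal (1 - a z.2.1 z.2.2) • Measure.dirac z.2.1) Set.univ = 1
  simp only [Measure.coe_add, Measure.coe_smul, Pi.add_apply, Pi.smul_apply, measure_univ,
    smul_eq_mul, mul_one]
  rw [← ENNReal.ofReal_add (A.acc_nonneg _ _) (sub_nonneg.2 (A.acc_le_one _ _))]
  simp

variable {Ω : Type*} [mΩ : MeasurableSpace Ω]

/-- An independence Metropolis–Hastings chain `X` with candidates `V` drawn from adaptive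
proposals `N` which change slowly and keep the weight `v` bounded below in mean. -/
structure IsAdaptiveChain (μ : Measure Ω) (𝓕 : ℕ → MeasurableSpace Ω) (a : G → G → ℝ) (v : G → ℝ)
    (N : ℕ → Ω → ProbMeas G) (X V : ℕ → Ω → G) (ε : ℝ) : Prop where
  le : ∀ k, 𝓕 k ≤ mΩ
  mono : Monotone 𝓕
  measurable_proposal : ∀ k, Measurable[𝓕 k] (N k)
  measurable_chain : ∀ k, Measurable[𝓕 k] (X k)
  measurable_candidate : ∀ k, Measurable[𝓕 (k + 1)] (V k)
  condExp_candidate : ∀ k (g : G → ℝ), Measurable g → (∀ z, |g z| ≤ 1) →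
    μ[fun ω => g (V k ω)|𝓕 k] =ᵐ[μ] fun ω => ∫ z, g z ∂(N k ω).1
  condExp_chain : ∀ k (g : G → ℝ), Measurable g → (∀ z, |g z| ≤ 1) →
    μ[fun ω => g (X (k + 1) ω)|𝓕 k ⊔ MeasurableSpace.comap (V k) inferInstance] =ᵐ[μ]
      fun ω => a (X k ω) (V k ω) * g (V k ω) + (1 - a (X k ω) (V k ω)) * g (X k ω)
  pos : 0 < ε
  minor : ∀ k, ∀ᵐ ω ∂μ, ε ≤ ∫ y, v y ∂(N k ω).1
  slow : ∀ k ω (g : G → ℝ), Measurable g → (∀ z, |g z| ≤ 1) →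
    |∫ y, g y ∂(N (k + 1) ω).1 - ∫ y, g y ∂(N k ω).1| ≤ 2 / (k + 1)

theorem sum_one_div_sqrt_le (n : ℕ) :
    ∑ k ∈ Finset.range n, 1 / √((k : ℝ) + 1) ≤ 2 * √(n : ℝ) := by
  induction n with
  | zero => simp
  | succ n ih =>
    rw [Finset.sum_range_succ]
    have h1 : 0 < √((n : ℝ) + 1) := Real.sqrt_pos.2 (by positivity)
    have h2 : √((n : ℝ) + 1) ^ 2 = n + 1 := Real.sq_sqrt (by positivity)
    have h3 : √(n : ℝ) ^ 2 = n := Real.sq_sqrt (by positivity)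
    have h4 : 1 / √((n : ℝ) + 1) ≤ 2 * √((n : ℝ) + 1) - 2 * √(n : ℝ) := by
      rw [div_le_iff₀ h1]
      nlinarith [sq_nonneg (√((n : ℝ) + 1) - √(n : ℝ))]
    push_cast
    linarith

theorem one_div_succ_le_one_div_sqrt (k : ℕ) : 1 / ((k : ℝ) + 1) ≤ 1 / √((k : ℝ) + 1) := by
  have h : (1 : ℝ) ≤ k + 1 := by linarith [k.cast_nonneg (α := ℝ)]
  refine one_div_le_one_div_of_le (Real.sqrt_pos.2 (by linarith)) ?_
  rw [Real.sqrt_le_left (by linarith)]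
  nlinarith

theorem eLpNorm_sum_range_le {μ : Measure Ω} {p : ℝ} (hp : 1 ≤ p) {F : ℕ → Ω → ℝ}
    (hF : ∀ k, AEStronglyMeasurable (F k) μ) {K : ℝ} (hK : 0 ≤ K)
    (hb : ∀ k : ℕ, eLpNorm (F k) (ENNReal.ofReal p) μ ≤ ENNReal.ofReal (K / √((k : ℝ) + 1)))
    (n : ℕ) :
    eLpNorm (fun ω => ∑ k ∈ Finset.range n, F k ω) (ENNReal.ofReal p) μ ≤
      ENNReal.ofReal (2 * K * √(n : ℝ)) := by
  have h1 := eLpNorm_sum_le (p := ENNReal.ofReal p) (μ := μ) (s := Finset.range n) (f := F)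
    (fun k _ => hF k) (by simpa using hp)
  have e : (fun ω => ∑ k ∈ Finset.range n, F k ω) = ∑ k ∈ Finset.range n, F k := by
    ext ω; simp
  rw [e]
  refine h1.trans ((Finset.sum_le_sum fun k _ => hb k).trans ?_)
  rw [← ENNReal.ofReal_sum_of_nonneg fun k _ => by positivity]
  refine ENNReal.ofReal_le_ofReal ?_
  have := mul_le_mul_of_nonneg_left (sum_one_div_sqrt_le n) hK
  rw [Finset.mul_sum] at this
  calc _ = ∑ k ∈ Finset.range n, K * (1 / √((k : ℝ) + 1)) := by simp [div_eq_mul_inv]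
    _ ≤ _ := by linarith

namespace IsAdaptiveChain

variable {μ : Measure Ω} {𝓕 : ℕ → MeasurableSpace Ω} {a : G → G → ℝ}
  {v : G → ℝ} {N : ℕ → Ω → ProbMeas G} {X V : ℕ → Ω → G} {ε : ℝ}
  (h : IsAdaptiveChain μ 𝓕 a v N X V ε) (A : IsAcceptance a v)

include h

theorem measurable_N (k : ℕ) : Measurable (N k) := (h.measurable_proposal k).mono (h.le k) le_rfl

theorem measurable_X (k : ℕ) : Measurable (X k) := (h.measurable_chain k).mono (h.le k) le_rfl

theorem measurable_V (k : ℕ) : Measurable (V k) :=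
  (h.measurable_candidate k).mono (h.le _) le_rfl

theorem measurable_integral_proposal (k : ℕ) {g : G → ℝ} (hg : Measurable g) :
    Measurable fun ω => ∫ y, g y ∂(N k ω).1 :=
  measurable_integral_probMeas (h.measurable_N k) (H := fun z => g z.2) (hg.comp measurable_snd)

variable [IsProbabilityMeasure μ]

theorem condExp_candidate_of_bound (k : ℕ) {H : ProbMeas G × G × G → ℝ} (hH : Measurable H)
    {c : ℝ} (hc : ∀ z, |H z| ≤ c) :
    μ[fun ω => H (N k ω, X k ω, V k ω)|𝓕 k] =ᵐ[μ]
      fun ω => ∫ y, H (N k ω, X k ω, y) ∂(N k ω).1 := by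
  have := condExp_freeze (h.le k) μ ((evalKernel G).comap (fun z : ProbMeas G × G => z.1)
    measurable_fst) (ζ := fun ω => (N k ω, X k ω))
    ((h.measurable_proposal k).prodMk (h.measurable_chain k)) (h.measurable_V k)
    (h.condExp_candidate k) (H := fun z => H (z.1.1, z.1.2, z.2))
    (hH.comp ((measurable_fst.comp measurable_fst).prodMk
      ((measurable_snd.comp measurable_fst).prodMk measurable_snd))) (fun z => hc _)
  exact this

include A in
theorem condExp_chain_of_bound (k : ℕ) {H : ProbMeas G × G → ℝ} (hH : Measurable H)
    {c : ℝ} (hc : ∀ z, |H z| ≤ c) :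
    μ[fun ω => H (N k ω, X (k + 1) ω)|𝓕 k] =ᵐ[μ]
      fun ω => mhOp a (N k ω).1 (fun y => H (N k ω, y)) (X k ω) := by
  have hle : 𝓕 k ⊔ MeasurableSpace.comap (V k) inferInstance ≤ mΩ :=
    sup_le (h.le k) (h.measurable_V k).comap_le
  have hVG : Measurable[𝓕 k ⊔ MeasurableSpace.comap (V k) inferInstance] (V k) :=
    (comap_measurable (V k)).mono le_sup_right le_rfl
  have hNG : Measurable[𝓕 k ⊔ MeasurableSpace.comap (V k) inferInstance] (N k) :=
    (h.measurable_proposal k).mono le_sup_left le_rfl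
  have hXG : Measurable[𝓕 k ⊔ MeasurableSpace.comap (V k) inferInstance] (X k) :=
    (h.measurable_chain k).mono le_sup_left le_rfl
  have h1 := condExp_freeze hle μ (moveKernel A) (ζ := fun ω => (N k ω, X k ω, V k ω))
    (hNG.prodMk (hXG.prodMk hVG)) (h.measurable_X (k + 1))
    (fun g hg hg1 => by
      refine (h.condExp_chain k g hg hg1).trans (Filter.Eventually.of_forall fun ω => ?_)
      exact (integral_moveKernel A (N k ω, X k ω, V k ω) hg hg1).symm)
    (H := fun z => H (z.1.1, z.2))
    (hH.comp ((measurable_fst.comp measurable_fst).prodMk measurable_snd)) (fun z => hc _)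
  have h2 : μ[fun ω => H (N k ω, X (k + 1) ω)|𝓕 k ⊔ MeasurableSpace.comap (V k) inferInstance] =ᵐ[μ]
      fun ω =>
      a (X k ω) (V k ω) * H (N k ω, V k ω) + (1 - a (X k ω) (V k ω)) * H (N k ω, X k ω) := by
    refine h1.trans (Filter.Eventually.of_forall fun ω => ?_)
    exact integral_moveKernel A (N k ω, X k ω, V k ω) (hH.comp measurable_prodMk_left)
      (fun x => hc _)
  refine (condExp_condExp_of_le le_sup_left hle).symm.trans ?_
  refine (condExp_congr_ae h2).trans ?_
  have ha : Measurable fun z : ProbMeas G × G × G => a z.2.1 z.2.2 :=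
    A.measurable_acc.comp measurable_snd
  exact h.condExp_candidate_of_bound k
    (H := fun z => a z.2.1 z.2.2 * H (z.1, z.2.2) + (1 - a z.2.1 z.2.2) * H (z.1, z.2.1))
    ((ha.mul (hH.comp (measurable_fst.prodMk (measurable_snd.comp measurable_snd)))).add
      ((measurable_const.sub ha).mul
        (hH.comp (measurable_fst.prodMk (measurable_fst.comp measurable_snd)))))
    (fun z => A.abs_mhIntegrand_le (h := fun y => H (z.1, y)) (fun y => hc _) z.2.1 z.2.2)

include A in
/-- Rate of convergence of the averages of rescaled weights of candidates. -/
theorem eLpNorm_weight_average_le {p : ℝ} (hp : 1 ≤ p) {K L : ℝ} (hK : 0 ≤ K)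
    (hlln : ∀ k : ℕ, eLpNorm (fun ω => ∫ y, v y ∂(N k ω).1 - L) (ENNReal.ofReal p) μ ≤
      ENNReal.ofReal (K / √((k : ℝ) + 1))) (n : ℕ) :
    eLpNorm (fun ω => ∑ k ∈ Finset.range n, (v (V k ω) - L)) (ENNReal.ofReal p) μ ≤
      ENNReal.ofReal ((2 * momentConst p + 2 * K) * √(n : ℝ)) := by
  have hV1 : ∀ k ω, |∫ y, v y ∂(N k ω).1| ≤ 1 := fun k ω => abs_integral_le A.abs_weight_le_one
  have hmI := fun k => h.measurable_integral_proposal k A.measurable_weight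
  have hmI' : ∀ k, Measurable[𝓕 k] fun ω => ∫ y, v y ∂(N k ω).1 := fun k =>
    (measurable_integral_probMeas (S := ProbMeas G) measurable_id (H := fun z => v z.2)
      (A.measurable_weight.comp measurable_snd)).comp (h.measurable_proposal k)
  have hmart := eLpNorm_martingale_sum_le (μ := μ) h.le h.mono
    (D := fun k ω => v (V k ω) - ∫ y, v y ∂(N k ω).1)
    (fun k => (A.measurable_weight.comp (h.measurable_candidate k)).sub
      ((hmI' k).mono (h.mono k.le_succ) le_rfl)) (b := 2) two_pos
    (fun k => Filter.Eventually.of_forall fun ω => (abs_sub _ _).trans (by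
      linarith [A.abs_weight_le_one (V k ω), hV1 k ω]))
    (fun k => by
      have i1 : Integrable (fun ω => v (V k ω)) μ := integrable_of_abs_le
        (A.measurable_weight.comp (h.measurable_V k)) (fun ω => A.abs_weight_le_one _)
      have i2 : Integrable (fun ω => ∫ y, v y ∂(N k ω).1) μ :=
        integrable_of_abs_le (hmI k) (hV1 k)
      refine (condExp_sub i1 i2 (𝓕 k)).trans ?_
      filter_upwards [h.condExp_candidate k v A.measurable_weight A.abs_weight_le_one] with ω hω
      rw [Pi.sub_apply, hω, condExp_of_stronglyMeasurable (h.le k) (hmI' k).stronglyMeasurable i2]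
      simp) hp n
  have hsum := eLpNorm_sum_range_le hp (fun k => ((hmI k).sub_const L).aestronglyMeasurable)
    hK hlln n
  have e : (fun ω => ∑ k ∈ Finset.range n, (v (V k ω) - L)) =
      (fun ω => ∑ k ∈ Finset.range n, (v (V k ω) - ∫ y, v y ∂(N k ω).1)) +
      fun ω => ∑ k ∈ Finset.range n, (∫ y, v y ∂(N k ω).1 - L) := by
    ext ω
    rw [Pi.add_apply, ← Finset.sum_add_distrib]
    simp
  rw [e]
  refine (eLpNorm_add_le ?_ ?_ (by simpa using hp)).trans ((add_le_add hmart hsum).trans ?_)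
  · exact (Finset.measurable_sum _ fun k _ =>
      (A.measurable_weight.comp (h.measurable_V k)).sub (hmI k)).aestronglyMeasurable
  · exact (Finset.measurable_sum _ fun k _ => (hmI k).sub_const L).aestronglyMeasurable
  · rw [← ENNReal.ofReal_add (by have := momentConst_nonneg p; positivity) (by positivity)]
    exact ENNReal.ofReal_le_ofReal (le_of_eq (by ring))

omit h [IsProbabilityMeasure μ] mΩ in
include A in
theorem _root_.Paper.IsAcceptance.measurable_mhOp_uncurry {H : ProbMeas G × G → ℝ}
    (hH : Measurable H) :
    Measurable fun z : ProbMeas G × G => mhOp a z.1.1 (fun y => H (z.1, y)) z.2 := by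
  have ha : Measurable fun z : (ProbMeas G × G) × G => a z.1.2 z.2 :=
    A.measurable_acc.comp ((measurable_snd.comp measurable_fst).prodMk measurable_snd)
  exact measurable_integral_probMeas (N := fun z : ProbMeas G × G => z.1) measurable_fst
    (H := fun z => a z.1.2 z.2 * H (z.1.1, z.2) + (1 - a z.1.2 z.2) * H (z.1.1, z.1.2))
    ((ha.mul (hH.comp ((measurable_fst.comp measurable_fst).prodMk measurable_snd))).add
      ((measurable_const.sub ha).mul (hH.comp measurable_fst)))

/-- The martingale increments attached to the approximate solutions of the Poisson equation. -/
def poissonIncr (a : G → G → ℝ) (v : G → ℝ) (N : ℕ → Ω → ProbMeas G) (X : ℕ → Ω → G)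
    (f : G → ℝ) (T k : ℕ) (ω : Ω) : ℝ :=
  poissonSol a v (N k ω).1 f T (X (k + 1) ω) -
    mhOp a (N k ω).1 (poissonSol a v (N k ω).1 f T) (X k ω)

include A in
theorem eLpNorm_sum_poissonIncr_le {f : G → ℝ} (hf : Measurable f) (hf1 : ∀ x, |f x| ≤ 1)
    {p : ℝ} (hp : 1 ≤ p) (T n : ℕ) :
    eLpNorm (fun ω => ∑ k ∈ Finset.range n, poissonIncr a v N X f T k ω) (ENNReal.ofReal p) μ ≤
      ENNReal.ofReal (momentConst p * (2 / ε * √(n : ℝ))) := by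
  have hsol := measurable_poissonSol_uncurry A hf T
  have hm1 : ∀ k, Measurable fun ω => poissonSol a v (N k ω).1 f T (X (k + 1) ω) := fun k =>
    hsol.comp ((h.measurable_N k).prodMk (h.measurable_X (k + 1)))
  have hm2 : ∀ k, Measurable[𝓕 k] fun ω =>
      mhOp a (N k ω).1 (poissonSol a v (N k ω).1 f T) (X k ω) := fun k =>
    (A.measurable_mhOp_uncurry hsol).comp
      ((h.measurable_proposal k).prodMk (h.measurable_chain k))
  have hbT : ∀ z : ProbMeas G × G, |poissonSol a v z.1.1 f T z.2| ≤ T := fun z =>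
    A.abs_poissonSol_le_nat hf hf1 T z.2
  refine eLpNorm_martingale_sum_le h.le h.mono (fun k => ?_) (div_pos two_pos h.pos)
    (fun k => ?_) (fun k => ?_) hp n
  · exact (hsol.comp (((h.measurable_proposal k).mono (h.mono k.le_succ) le_rfl).prodMk
      (h.measurable_chain (k + 1)))).sub ((hm2 k).mono (h.mono k.le_succ) le_rfl)
  · filter_upwards [h.minor k] with ω hω
    have hb := A.abs_poissonSol_le h.pos hf hf1 hω T
    refine (abs_sub _ _).trans ((add_le_add (hb _) (A.abs_mhOp_le hb _)).trans (le_of_eq ?_))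
    ring
  · have i1 : Integrable (fun ω => poissonSol a v (N k ω).1 f T (X (k + 1) ω)) μ :=
      integrable_of_abs_le (hm1 k) fun ω => hbT (N k ω, _)
    have i2 : Integrable (fun ω => mhOp a (N k ω).1 (poissonSol a v (N k ω).1 f T) (X k ω)) μ :=
      integrable_of_abs_le ((hm2 k).mono (h.le k) le_rfl) fun ω =>
        A.abs_mhOp_le (fun x => hbT (N k ω, x)) _
    refine (condExp_sub i1 i2 (𝓕 k)).trans ?_
    filter_upwards [h.condExp_chain_of_bound A k hsol hbT] with ω hω
    rw [Pi.sub_apply, hω, condExp_of_stronglyMeasurable (h.le k) (hm2 k).stronglyMeasurable i2]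
    simp

omit h [IsProbabilityMeasure μ] in
theorem abs_div_sub_le {x y l c ε : ℝ} (hε : 0 < ε) (hy : ε ≤ y) (hc : |c| ≤ 1) :
    |x / y - c| ≤ ε⁻¹ * (|x - l * c| + |y - l|) := by
  have hy0 : 0 < y := hε.trans_le hy
  have e : x / y - c = ((x - l * c) - c * (y - l)) / y := by field_simp; ring
  rw [e, abs_div, abs_of_pos hy0, div_eq_inv_mul]
  have h1 : |(x - l * c) - c * (y - l)| ≤ |x - l * c| + |y - l| := by
    refine (abs_sub _ _).trans ?_
    rw [abs_mul]
    have := mul_le_mul_of_nonneg_right hc (abs_nonneg (y - l))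
    linarith
  exact mul_le_mul (inv_anti₀ hε hy) h1 (abs_nonneg _) (inv_nonneg.2 hε.le)

omit [IsProbabilityMeasure μ] in
include A in
theorem abs_sum_sub_le {f : G → ℝ} (hf : Measurable f) (hf1 : ∀ x, |f x| ≤ 1) {c L : ℝ}
    (hc : |c| ≤ 1) (T n : ℕ) {ω : Ω} (hω : ∀ k, ε ≤ ∫ y, v y ∂(N k ω).1) :
    |∑ k ∈ Finset.range n, (f (X k ω) - c)| ≤
      n * (2 * (1 - ε) ^ T) + 2 / ε + 4 / ε ^ 2 * √(n : ℝ) +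
      |∑ k ∈ Finset.range n, poissonIncr a v N X f T k ω| +
      ∑ k ∈ Finset.range n, ε⁻¹ *
        (|∫ y, v y * f y ∂(N k ω).1 - L * c| + |∫ y, v y ∂(N k ω).1 - L|) := by
  set s : ℕ → G → ℝ := fun k => poissonSol a v (N k ω).1 f T with hs
  have hb : ∀ k x, |s k x| ≤ 1 / ε := fun k => A.abs_poissonSol_le h.pos hf hf1 (hω k) T
  have hε := h.pos
  have e : ∑ k ∈ Finset.range n, (f (X k ω) - c) =
      ∑ k ∈ Finset.range n, (f (X k ω) - (∫ y, v y * f y ∂(N k ω).1) / (∫ y, v y ∂(N k ω).1) -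
        (s k (X k ω) - mhOp a (N k ω).1 (s k) (X k ω))) +
      ∑ k ∈ Finset.range n, (s k (X k ω) - s (k + 1) (X (k + 1) ω)) +
      ∑ k ∈ Finset.range n, (s (k + 1) (X (k + 1) ω) - s k (X (k + 1) ω)) +
      ∑ k ∈ Finset.range n, poissonIncr a v N X f T k ω +
      ∑ k ∈ Finset.range n,
        ((∫ y, v y * f y ∂(N k ω).1) / (∫ y, v y ∂(N k ω).1) - c) := by
    simp only [← Finset.sum_add_distrib]
    refine Finset.sum_congr rfl fun k _ => ?_
    simp only [poissonIncr, hs]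
    ring
  have t1 : |∑ k ∈ Finset.range n, (f (X k ω) -
      (∫ y, v y * f y ∂(N k ω).1) / (∫ y, v y ∂(N k ω).1) -
        (s k (X k ω) - mhOp a (N k ω).1 (s k) (X k ω)))| ≤ n * (2 * (1 - ε) ^ T) := by
    refine (Finset.abs_sum_le_sum_abs _ _).trans ((Finset.sum_le_sum fun k _ =>
      A.abs_poisson_error_le h.pos hf hf1 (hω k) T (X k ω)).trans ?_)
    simp
  have t2 : |∑ k ∈ Finset.range n, (s k (X k ω) - s (k + 1) (X (k + 1) ω))| ≤ 2 / ε := by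
    rw [Finset.sum_range_sub' (fun k => s k (X k ω))]
    refine (abs_sub _ _).trans ((add_le_add (hb _ _) (hb _ _)).trans (le_of_eq ?_))
    ring
  have t3 : |∑ k ∈ Finset.range n, (s (k + 1) (X (k + 1) ω) - s k (X (k + 1) ω))| ≤
      4 / ε ^ 2 * √(n : ℝ) := by
    have : ∀ k ∈ Finset.range n, |s (k + 1) (X (k + 1) ω) - s k (X (k + 1) ω)| ≤
        2 / ε ^ 2 * (1 / √((k : ℝ) + 1)) := by
      intro k _
      refine (A.abs_poissonSol_sub_le h.pos hf hf1 (hω k) (hω (k + 1)) (τ := 2 / (k + 1))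
        (by positivity) (h.slow k ω) T _).trans ?_
      have := mul_le_mul_of_nonneg_left (one_div_succ_le_one_div_sqrt k)
        (show 0 ≤ 2 / ε ^ 2 by positivity)
      refine le_trans (le_of_eq ?_) this
      field_simp
    refine (Finset.abs_sum_le_sum_abs _ _).trans ((Finset.sum_le_sum this).trans ?_)
    rw [← Finset.mul_sum]
    refine (mul_le_mul_of_nonneg_left (sum_one_div_sqrt_le n)
      (show 0 ≤ 2 / ε ^ 2 by positivity)).trans (le_of_eq ?_)
    ring
  have t5 : |∑ k ∈ Finset.range n,
        ((∫ y, v y * f y ∂(N k ω).1) / (∫ y, v y ∂(N k ω).1) - c)| ≤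
      ∑ k ∈ Finset.range n, ε⁻¹ *
        (|∫ y, v y * f y ∂(N k ω).1 - L * c| + |∫ y, v y ∂(N k ω).1 - L|) :=
    (Finset.abs_sum_le_sum_abs _ _).trans (Finset.sum_le_sum fun k _ =>
      abs_div_sub_le h.pos (hω k) hc)
  rw [e]
  refine (abs_add_le _ _).trans (add_le_add ((abs_add_le _ _).trans (add_le_add
    ((abs_add_le _ _).trans (add_le_add ((abs_add_le _ _).trans (add_le_add t1 t2)) t3))
    le_rfl)) t5)

end IsAdaptiveChain

/-- The constant in the rate of convergence of an adaptive chain. -/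
def chainConst (ε K p : ℝ) : ℝ :=
  2 + 2 / ε + 4 / ε ^ 2 + momentConst p * (2 / ε) + ε⁻¹ * (4 * K)

theorem chainConst_nonneg {ε K p : ℝ} (hε : 0 < ε) (hK : 0 ≤ K) : 0 ≤ chainConst ε K p := by
  have := momentConst_nonneg p
  unfold chainConst
  positivity

/-- If the proposals satisfy a law of large numbers with rate `1 / √k`, so does the chain. -/
theorem IsAdaptiveChain.eLpNorm_sum_sub_le {μ : Measure Ω} [IsProbabilityMeasure μ]
    {𝓕 : ℕ → MeasurableSpace Ω} {a : G → G → ℝ} {v : G → ℝ} {N : ℕ → Ω → ProbMeas G}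
    {X V : ℕ → Ω → G} {ε : ℝ} (h : IsAdaptiveChain μ 𝓕 a v N X V ε) (A : IsAcceptance a v)
    {f : G → ℝ} (hf : Measurable f) (hf1 : ∀ x, |f x| ≤ 1) {c L : ℝ} (hc : |c| ≤ 1)
    {p : ℝ} (hp : 1 ≤ p) {K : ℝ} (hK : 0 ≤ K)
    (hlln : ∀ k : ℕ, eLpNorm (fun ω => ∫ y, v y * f y ∂(N k ω).1 - L * c) (ENNReal.ofReal p) μ ≤
      ENNReal.ofReal (K / √((k : ℝ) + 1)))
    (hlln1 : ∀ k : ℕ, eLpNorm (fun ω => ∫ y, v y ∂(N k ω).1 - L) (ENNReal.ofReal p) μ ≤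
      ENNReal.ofReal (K / √((k : ℝ) + 1))) {n : ℕ} (hn : 1 ≤ n) :
    eLpNorm (fun ω => ∑ k ∈ Finset.range n, (f (X k ω) - c)) (ENNReal.ofReal p) μ ≤
      ENNReal.ofReal (chainConst ε K p * √(n : ℝ)) := by
  have hε := h.pos
  have hp' : (1 : ℝ≥0∞) ≤ ENNReal.ofReal p := by simpa using hp
  have hn1 : 1 ≤ √(n : ℝ) := Real.one_le_sqrt.2 (by exact_mod_cast hn)
  obtain ⟨T, hT⟩ := exists_pow_lt_of_lt_one (show (0 : ℝ) < 1 / n by positivity)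
    (show 1 - ε < 1 by linarith)
  have hT' : (n : ℝ) * (2 * (1 - ε) ^ T) ≤ 2 := by
    have h0 : (0 : ℝ) < n := by positivity
    rw [lt_div_iff₀ h0] at hT
    linarith
  have mf := fun k => h.measurable_integral_proposal k (A.measurable_weight.mul hf)
  have mv := fun k => h.measurable_integral_proposal k A.measurable_weight
  have mA : ∀ k, AEStronglyMeasurable (fun ω => |∫ y, v y * f y ∂(N k ω).1 - L * c|) μ :=
    fun k => (continuous_abs.measurable.comp ((mf k).sub_const _)).aestronglyMeasurable
  have mB : ∀ k, AEStronglyMeasurable (fun ω => |∫ y, v y ∂(N k ω).1 - L|) μ :=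
    fun k => (continuous_abs.measurable.comp ((mv k).sub_const _)).aestronglyMeasurable
  have mD : AEStronglyMeasurable
      (fun ω => |∑ k ∈ Finset.range n, IsAdaptiveChain.poissonIncr a v N X f T k ω|) μ := by
    have hsol := measurable_poissonSol_uncurry A hf T
    refine (continuous_abs.measurable.comp
      (Finset.measurable_sum _ fun k _ => ?_)).aestronglyMeasurable
    exact (hsol.comp ((h.measurable_N k).prodMk (h.measurable_X (k + 1)))).sub
      ((A.measurable_mhOp_uncurry hsol).comp ((h.measurable_N k).prodMk (h.measurable_X k)))
  set S : ℝ := 2 + 2 / ε + 4 / ε ^ 2 * √(n : ℝ) with hS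
  have hS0 : 0 ≤ S := by positivity
  set D := fun ω => |∑ k ∈ Finset.range n, IsAdaptiveChain.poissonIncr a v N X f T k ω| with hD
  set W := fun ω => ∑ k ∈ Finset.range n, ε⁻¹ *
        (|∫ y, v y * f y ∂(N k ω).1 - L * c| + |∫ y, v y ∂(N k ω).1 - L|) with hW
  have mAB : ∀ k, AEStronglyMeasurable (fun ω => ε⁻¹ *
      (|∫ y, v y * f y ∂(N k ω).1 - L * c| + |∫ y, v y ∂(N k ω).1 - L|)) μ :=
    fun k => ((mA k).add (mB k)).const_mul _
  have mW : AEStronglyMeasurable W μ := Finset.aestronglyMeasurable_fun_sum _ fun k _ => mAB k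
  have bW : eLpNorm W (ENNReal.ofReal p) μ ≤
      ENNReal.ofReal (2 * (ε⁻¹ * (2 * K)) * √(n : ℝ)) := by
    refine eLpNorm_sum_range_le hp mAB (by positivity) (fun k => ?_) n
    have h1 : eLpNorm (fun ω => |∫ y, v y * f y ∂(N k ω).1 - L * c| +
        |∫ y, v y ∂(N k ω).1 - L|) (ENNReal.ofReal p) μ ≤
        ENNReal.ofReal (2 * K / √((k : ℝ) + 1)) := by
      refine (eLpNorm_add_le (mA k) (mB k) hp').trans ?_
      have e1 := hlln k
      have e2 := hlln1 k
      rw [← eLpNorm_norm] at e1 e2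
      refine (add_le_add e1 e2).trans (le_of_eq ?_)
      rw [← ENNReal.ofReal_add (by positivity) (by positivity)]
      congr 1; ring
    have h2 := eLpNorm_const_smul_le (c := ε⁻¹) (f := fun ω =>
      |∫ y, v y * f y ∂(N k ω).1 - L * c| + |∫ y, v y ∂(N k ω).1 - L|)
      (p := ENNReal.ofReal p) (μ := μ)
    refine h2.trans ((mul_le_mul_right h1 _).trans (le_of_eq ?_))
    rw [Real.enorm_eq_ofReal (by positivity), ← ENNReal.ofReal_mul (by positivity)]
    congr 1; ring
  have bD : eLpNorm D (ENNReal.ofReal p) μ ≤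
      ENNReal.ofReal (momentConst p * (2 / ε * √(n : ℝ))) := by
    have := h.eLpNorm_sum_poissonIncr_le A hf hf1 hp T n
    rwa [← eLpNorm_norm] at this
  have bS : eLpNorm (fun _ : Ω => S) (ENNReal.ofReal p) μ = ENNReal.ofReal S := by
    rw [eLpNorm_const _ (by positivity) (IsProbabilityMeasure.ne_zero μ)]
    simp [Real.enorm_eq_ofReal hS0]
  have hpt : ∀ᵐ ω ∂μ, ‖∑ k ∈ Finset.range n, (f (X k ω) - c)‖ ≤
      ‖((fun _ : Ω => S) + D + W) ω‖ := by
    filter_upwards [ae_all_iff.2 h.minor] with ω hω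
    refine le_trans ?_ (le_abs_self _)
    refine (h.abs_sum_sub_le A hf hf1 (L := L) hc T n hω).trans ?_
    simp only [Pi.add_apply, hD, hW, hS]
    linarith
  refine (eLpNorm_mono_ae hpt).trans ?_
  refine (eLpNorm_add_le (aestronglyMeasurable_const.add mD) mW hp').trans ?_
  refine (add_le_add (eLpNorm_add_le aestronglyMeasurable_const mD hp') le_rfl).trans ?_
  rw [bS]
  refine (add_le_add (add_le_add le_rfl bD) bW).trans ?_
  have := momentConst_nonneg p
  rw [← ENNReal.ofReal_add hS0 (by positivity), ← ENNReal.ofReal_add (by positivity)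
    (by positivity)]
  refine ENNReal.ofReal_le_ofReal ?_
  have h3 : 2 + 2 / ε ≤ (2 + 2 / ε) * √(n : ℝ) := le_mul_of_one_le_right (by positivity) hn1
  rw [chainConst, hS]
  linarith

end AdaptiveChain

section Model

open ProbabilityTheory

section Weight

variable {G : Type*} [MeasurableSpace G] {w : G → ℝ≥0∞} {b : ℝ≥0∞}

theorem isAcceptance_acc (hw : Measurable w) (hb : b ≠ ⊤) (hwb : ∀ x, w x ≤ b) :
    IsAcceptance (fun x y => (acc w x y).toReal) fun x => (w x / b).toReal where
  measurable_acc := (measurable_const.min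
    ((hw.comp measurable_snd).div (hw.comp measurable_fst))).ennreal_toReal
  measurable_weight := (hw.div_const b).ennreal_toReal
  acc_le_one x y := ENNReal.toReal_le_of_le_ofReal zero_le_one (by simp [acc])
  weight_nonneg x := ENNReal.toReal_nonneg
  weight_le_acc x y := by
    refine ENNReal.toReal_mono (ne_top_of_le_ne_top ENNReal.one_ne_top (min_le_left _ _))
      (le_min ?_ (ENNReal.div_le_div_left (hwb x) _))
    exact (ENNReal.div_le_div_right (hwb y) _).trans ENNReal.div_self_le_one
  symm x y := by
    have key : ∀ x y, w x / b * acc w x y = min (w x) (w y) / b := fun x y => by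
      have hx : w x ≠ ⊤ := ne_top_of_le_ne_top hb (hwb x)
      rw [div_eq_mul_inv, div_eq_mul_inv]
      rcases eq_or_ne (w x) 0 with h0 | h0
      · simp [h0]
      · rw [acc, mul_right_comm, ← min_mul_mul_left, mul_one, ENNReal.mul_div_cancel h0 hx]
    simp only [← ENNReal.toReal_mul, key, min_comm (w x)]

/-- Bounded functions integrate against the rescaled weight as against the reweighted measure. -/
theorem integral_weight_mul {ν T : Measure G} (hw : Measurable w) (hb0 : b ≠ 0) (hb : b ≠ ⊤)
    (hwb : ∀ x, w x ≤ b) {r : ℝ≥0∞} (h : ν.withDensity (fun x => w x / b) = r • T)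
    (f : G → ℝ) : ∫ x, (w x / b).toReal * f x ∂ν = r.toReal * ∫ x, f x ∂T := by
  have hlt : ∀ᵐ x ∂ν, w x / b < ⊤ := Filter.Eventually.of_forall fun x =>
    (ENNReal.div_lt_top (ne_top_of_le_ne_top hb (hwb x)) hb0)
  have := integral_withDensity_eq_integral_toReal_smul (hw.div_const b) hlt f
  rw [h, integral_smul_measure] at this
  simpa [smul_eq_mul] using this.symm

end Weight

section Snoc

theorem measurable_snoc (m : ℕ) :
    Measurable fun p : (Fin m → E) × E => (Fin.snoc p.1 p.2 : Fin (m + 1) → E) := by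
  refine measurable_pi_lambda _ fun i => ?_
  refine Fin.lastCases ?_ (fun j => ?_) i
  · simpa using measurable_snd
  · simpa [Function.comp_def] using (measurable_pi_apply j).comp (measurable_fst (β := E))

theorem lintegral_pi_snoc (dx : Measure E) [SigmaFinite dx] (m : ℕ)
    {F : (Fin (m + 1) → E) → ℝ≥0∞} (hF : Measurable F) :
    ∫⁻ x, F x ∂(Measure.pi fun _ : Fin (m + 1) => dx) =
      ∫⁻ z, ∫⁻ y, F (Fin.snoc z y) ∂dx ∂(Measure.pi fun _ : Fin m => dx) := by
  have h := (measurePreserving_piFinSuccAbove (fun _ : Fin (m + 1) => dx) (Fin.last m)).symm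
  rw [← h.lintegral_comp hF]
  refine (lintegral_prod_symm' _ (hF.comp (MeasurableEquiv.measurable _))).trans ?_
  simp [MeasurableEquiv.piFinSuccAbove_symm_apply, Fin.insertNthEquiv, Fin.insertNth_last']

theorem lintegral_pi_one (dx : Measure E) [SigmaFinite dx] {F : (Fin 1 → E) → ℝ≥0∞}
    (hF : Measurable F) :
    ∫⁻ x, F x ∂(Measure.pi fun _ : Fin 1 => dx) = ∫⁻ y, F (fun _ => y) ∂dx := by
  have h := (measurePreserving_funUnique dx (Fin 1)).symm
  exact (h.lintegral_comp hF).symm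

end Snoc

section Step

variable {dx : Measure E} [SigmaFinite dx]
  {q : (m : ℕ) → (Fin m → E) → E → ℝ≥0∞} {m : ℕ}

theorem lintegral_propM (hq : Measurable fun p : (Fin m → E) × E => q m p.1 p.2)
    (ν : Measure (Fin m → E)) [SFinite ν] {F : (Fin (m + 1) → E) → ℝ≥0∞} (hF : Measurable F) :
    ∫⁻ x, F x ∂propM dx q m ν = ∫⁻ z, ∫⁻ y, q m z y * F (Fin.snoc z y) ∂dx ∂ν := by
  have hF' := hF.comp (measurable_snoc (E := E) m)
  rw [propM, lintegral_map hF (measurable_snoc m)]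
  refine (lintegral_withDensity_eq_lintegral_mul _ hq hF').trans ?_
  exact lintegral_prod _ (hq.mul hF').aemeasurable

/-- The law of the candidate given the state picked at the previous level. -/
def stepKernel (dx : Measure E) [SigmaFinite dx] (q : (m : ℕ) → (Fin m → E) → E → ℝ≥0∞) (m : ℕ)
    (hq : Measurable fun p : (Fin m → E) × E => q m p.1 p.2) :
    Kernel (Fin m → E) (Fin (m + 1) → E) where
  toFun z := propM dx q m (Measure.dirac z)
  measurable' := by
    refine Measure.measurable_of_measurable_coe _ fun s hs => ?_
    have hm : Measurable fun p : (Fin m → E) × E =>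
        q m p.1 p.2 * s.indicator 1 (Fin.snoc p.1 p.2 : Fin (m + 1) → E) :=
      hq.mul ((measurable_one.indicator hs).comp (measurable_snoc m))
    have e : (fun z => propM dx q m (Measure.dirac z) s) = fun z =>
        ∫⁻ y, q m z y * s.indicator 1 (Fin.snoc z y : Fin (m + 1) → E) ∂dx := by
      funext z
      rw [← lintegral_indicator_one hs, lintegral_propM hq _ (measurable_one.indicator hs),
        lintegral_dirac' _ hm.lintegral_prod_right']
    rw [e]
    exact hm.lintegral_prod_right'

variable (hq : Measurable fun p : (Fin m → E) × E => q m p.1 p.2)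

theorem lintegral_stepKernel (z : Fin m → E) {F : (Fin (m + 1) → E) → ℝ≥0∞} (hF : Measurable F) :
    ∫⁻ x, F x ∂stepKernel dx q m hq z = ∫⁻ y, q m z y * F (Fin.snoc z y) ∂dx := by
  have hm : Measurable fun p : (Fin m → E) × E => q m p.1 p.2 * F (Fin.snoc p.1 p.2) :=
    hq.mul (hF.comp (measurable_snoc m))
  rw [← lintegral_dirac' z hm.lintegral_prod_right']
  exact lintegral_propM hq _ hF

theorem propM_eq_bind (ν : Measure (Fin m → E)) [SFinite ν] :
    propM dx q m ν = ν.bind (stepKernel dx q m hq) := by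
  ext s hs
  rw [Measure.bind_apply hs (stepKernel dx q m hq).aemeasurable, ← lintegral_indicator_one hs,
    lintegral_propM hq _ (measurable_one.indicator hs)]
  refine lintegral_congr fun z => ?_
  rw [← lintegral_indicator_one hs, lintegral_stepKernel hq z (measurable_one.indicator hs)]

theorem isMarkovKernel_stepKernel (hd : ∀ z, ∫⁻ y, q m z y ∂dx = 1) :
    IsMarkovKernel (stepKernel dx q m hq) := by
  refine ⟨fun z => ⟨?_⟩⟩
  rw [← lintegral_one, lintegral_stepKernel hq z measurable_const]
  simpa using hd z

theorem integral_propM (hd : ∀ z, ∫⁻ y, q m z y ∂dx = 1) (ν : Measure (Fin m → E))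
    [IsProbabilityMeasure ν] {f : (Fin (m + 1) → E) → ℝ} (hf : Measurable f) {c : ℝ}
    (hc : ∀ x, |f x| ≤ c) :
    ∫ x, f x ∂propM dx q m ν = ∫ z, ∫ x, f x ∂stepKernel dx q m hq z ∂ν := by
  have := isMarkovKernel_stepKernel hq hd
  have h := Kernel.integral_comp (κ := Kernel.const Unit ν) (η := stepKernel dx q m hq) (a := ())
    (integrable_of_abs_le hf hc)
  rw [Kernel.comp_apply, Kernel.const_apply, ← propM_eq_bind hq] at h
  exact h

end Step

section Emp

variable {Ω : Type*} (X : (n : ℕ) → ℕ → Ω → (Fin n → E))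
  (n i : ℕ)

instance (ω : Ω) : IsProbabilityMeasure (emp X n i ω) := by
  refine ⟨?_⟩
  simp only [emp, Measure.coe_smul, Measure.coe_finsetSum, Pi.smul_apply, Finset.sum_apply,
    measure_univ, Finset.sum_const, Finset.card_range, smul_eq_mul, nsmul_eq_mul, mul_one]
  push_cast
  exact ENNReal.inv_mul_cancel (by simp) (by finiteness)

theorem integral_emp (ω : Ω) {φ : (Fin n → E) → ℝ} (hφ : Measurable φ) {c : ℝ}
    (hc : ∀ x, |φ x| ≤ c) :
    ∫ z, φ z ∂emp X n i ω = ((i : ℝ) + 1)⁻¹ * ∑ k ∈ Finset.range (i + 1), φ (X n k ω) := by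
  rw [emp, integral_smul_measure, integral_finsetSum_measure fun k _ => integrable_of_abs_le hφ hc]
  simp only [integral_dirac' _ _ hφ.stronglyMeasurable, smul_eq_mul]
  congr 1
  rw [ENNReal.toReal_inv, ENNReal.toReal_add (by finiteness) (by finiteness)]
  simp

theorem measurable_emp {_ : MeasurableSpace Ω} (hX : ∀ k ≤ i, Measurable (X n k)) :
    Measurable (emp X n i) := by
  refine Measure.measurable_of_measurable_coe _ fun s hs => ?_
  simp only [emp, Measure.coe_smul, Measure.coe_finsetSum, Pi.smul_apply, Finset.sum_apply,
    smul_eq_mul]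
  exact (Finset.measurable_sum _ fun k hk => (Measure.measurable_coe hs).comp
    (Measure.measurable_dirac.comp (hX k (Nat.lt_succ_iff.1 (Finset.mem_range.1 hk))))).const_mul _

theorem abs_integral_emp_succ_sub_le (ω : Ω) {φ : (Fin n → E) → ℝ} (hφ : Measurable φ)
    (hφ1 : ∀ x, |φ x| ≤ 1) :
    |∫ z, φ z ∂emp X n (i + 1) ω - ∫ z, φ z ∂emp X n i ω| ≤ 2 / (i + 1) := by
  have h1 := integral_emp X n i ω hφ hφ1
  have h2 := integral_emp X n (i + 1) ω hφ hφ1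
  rw [Finset.sum_range_succ] at h2
  have hi : (0 : ℝ) < i + 1 := by positivity
  have hi2 : (0 : ℝ) < i + 2 := by positivity
  have hI : |∫ z, φ z ∂emp X n i ω| ≤ 1 := abs_integral_le hφ1
  have hS : ∑ k ∈ Finset.range (i + 1), φ (X n k ω) = (i + 1) * ∫ z, φ z ∂emp X n i ω := by
    rw [h1]; field_simp
  have e : ∫ z, φ z ∂emp X n (i + 1) ω - ∫ z, φ z ∂emp X n i ω =
      (φ (X n (i + 1) ω) - ∫ z, φ z ∂emp X n i ω) / (i + 2) := by
    rw [h2, hS]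
    push_cast
    field_simp
    ring
  rw [e, abs_div, abs_of_pos hi2]
  refine div_le_div₀ zero_le_two ((abs_sub _ _).trans ?_) hi (by linarith)
  linarith [hφ1 (X n (i + 1) ω)]

end Emp

section Assumptions

variable (dx : Measure E) (P : ℕ) (γ : (n : ℕ) → (Fin n → E) → ℝ≥0∞)
  (Z : ℕ → ℝ≥0∞) (q1 : E → ℝ≥0∞) (q : (m : ℕ) → (Fin m → E) → E → ℝ≥0∞) (B : ℕ → ℝ≥0∞)

/-- The assumptions on the targets and the proposals. -/
structure IsModel : Prop where
  one_le : 1 ≤ P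
  measurable_target : ∀ n, 1 ≤ n → n ≤ P → Measurable (γ n)
  target_ne_top : ∀ n, 1 ≤ n → n ≤ P → ∀ x, γ n x ≠ ⊤
  norm_eq : ∀ n, 1 ≤ n → n ≤ P → Z n = ∫⁻ x, γ n x ∂(Measure.pi fun _ : Fin n => dx)
  norm_pos : ∀ n, 1 ≤ n → n ≤ P → 0 < Z n
  norm_ne_top : ∀ n, 1 ≤ n → n ≤ P → Z n ≠ ⊤
  measurable_init : Measurable q1
  init_pos : ∀ y, 0 < q1 y
  init_ne_top : ∀ y, q1 y ≠ ⊤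
  lintegral_init : ∫⁻ y, q1 y ∂dx = 1
  measurable_step : ∀ m, 1 ≤ m → m + 1 ≤ P → Measurable fun p : (Fin m → E) × E => q m p.1 p.2
  step_pos : ∀ m x y, 0 < q m x y
  step_ne_top : ∀ m x y, q m x y ≠ ⊤
  lintegral_step : ∀ m, 1 ≤ m → m + 1 ≤ P → ∀ x, ∫⁻ y, q m x y ∂dx = 1
  bound_ne_top : ∀ n, 1 ≤ n → n ≤ P → B n ≠ ⊤
  wgt1_le_of_pos : ∀ x : Fin 1 → E, 0 < γ 1 x / Z 1 → wgt1 γ q1 x ≤ B 1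
  wgt_le_of_pos : ∀ m, 1 ≤ m → m + 1 ≤ P → ∀ x : Fin (m + 1) → E,
    0 < γ (m + 1) x / Z (m + 1) → wgt γ q m x ≤ B (m + 1)
  le_ratio : ∀ m, 1 ≤ m → m + 1 ≤ P → ∃ δ : ℝ≥0∞, 0 < δ ∧
    ∀ x : Fin m → E, 0 < γ m x / Z m → δ ≤ ratio dx γ Z m x

variable {dx P γ Z q1 q B}

namespace IsModel

variable (M : IsModel dx P γ Z q1 q B)

include M

theorem isProbabilityMeasure_tgt [SigmaFinite dx] {n : ℕ} (h1 : 1 ≤ n) (hn : n ≤ P) :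
    IsProbabilityMeasure (tgt dx γ Z n) := by
  refine ⟨?_⟩
  rw [tgt, withDensity_apply _ MeasurableSet.univ, Measure.restrict_univ]
  simp only [div_eq_mul_inv]
  rw [lintegral_mul_const _ (M.measurable_target n h1 hn), ← M.norm_eq n h1 hn]
  exact ENNReal.mul_inv_cancel (M.norm_pos n h1 hn).ne' (M.norm_ne_top n h1 hn)

theorem pos_div_norm {n : ℕ} (h1 : 1 ≤ n) (hn : n ≤ P) {x : Fin n → E} :
    0 < γ n x / Z n ↔ γ n x ≠ 0 := by
  rw [pos_iff_ne_zero, ne_eq, ENNReal.div_eq_zero_iff, not_or]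
  exact ⟨fun h => h.1, fun h => ⟨h, M.norm_ne_top n h1 hn⟩⟩

theorem wgt1_le (x : Fin 1 → E) : wgt1 γ q1 x ≤ B 1 := by
  by_cases h : γ 1 x = 0
  · simp [wgt1, h]
  · exact M.wgt1_le_of_pos x ((M.pos_div_norm le_rfl M.one_le).2 h)

theorem measurable_wgt1 : Measurable (wgt1 γ q1) :=
  (M.measurable_target 1 le_rfl M.one_le).div (M.measurable_init.comp (measurable_pi_apply 0))

theorem isProbabilityMeasure_prop1 : IsProbabilityMeasure (prop1 dx q1) := by
  have : IsProbabilityMeasure (dx.withDensity q1) :=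
    ⟨by rw [withDensity_apply _ MeasurableSet.univ, Measure.restrict_univ, M.lintegral_init]⟩
  exact Measure.isProbabilityMeasure_map (by fun_prop)

theorem lintegral_prop1_withDensity [SigmaFinite dx] {F : (Fin 1 → E) → ℝ≥0∞} (hF : Measurable F) :
    ∫⁻ x, wgt1 γ q1 x * F x ∂prop1 dx q1 =
      ∫⁻ x, γ 1 x * F x ∂(Measure.pi fun _ : Fin 1 => dx) := by
  have hc : Measurable fun y : E => fun _ : Fin 1 => y := by fun_prop
  have hwF : Measurable fun x => wgt1 γ q1 x * F x := M.measurable_wgt1.mul hF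
  have hγF : Measurable fun x => γ 1 x * F x := (M.measurable_target 1 le_rfl M.one_le).mul hF
  rw [lintegral_pi_one dx hγF]
  refine (lintegral_map hwF hc).trans
    ((lintegral_withDensity_eq_lintegral_mul _ M.measurable_init (hwF.comp hc)).trans ?_)
  refine lintegral_congr fun y => ?_
  show q1 y * (γ 1 (fun _ => y) / q1 y * F fun _ => y) = _
  rw [← mul_assoc, ENNReal.mul_div_cancel (M.init_pos y).ne' (M.init_ne_top y)]

theorem withDensity_wgt1 [SigmaFinite dx] (b : ℝ≥0∞) :
    (prop1 dx q1).withDensity (fun x => wgt1 γ q1 x / b) = (Z 1 / b) • tgt dx γ Z 1 := by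
  ext s hs
  have hi : Measurable (s.indicator (1 : (Fin 1 → E) → ℝ≥0∞)) := measurable_one.indicator hs
  have hγ := M.measurable_target 1 le_rfl M.one_le
  have h := M.lintegral_prop1_withDensity hi
  have e : ∀ g : (Fin 1 → E) → ℝ≥0∞, (fun x => g x * s.indicator 1 x) = s.indicator g := by
    intro g
    ext x
    by_cases hx : x ∈ s <;> simp [hx]
  rw [e, e, lintegral_indicator hs, lintegral_indicator hs] at h
  rw [withDensity_apply _ hs, Measure.smul_apply, tgt, withDensity_apply _ hs, smul_eq_mul]
  simp only [div_eq_mul_inv]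
  rw [lintegral_mul_const _ M.measurable_wgt1, h, lintegral_mul_const _ hγ]
  calc _ = b⁻¹ * (∫⁻ x in s, γ 1 x ∂(Measure.pi fun _ : Fin 1 => dx)) * (Z 1 * (Z 1)⁻¹) := by
        rw [ENNReal.mul_inv_cancel (M.norm_pos 1 le_rfl M.one_le).ne'
          (M.norm_ne_top 1 le_rfl M.one_le), mul_one, mul_comm]
    _ = _ := by ring

variable {m : ℕ} (h1 : 1 ≤ m) (hm : m + 1 ≤ P)

include h1 hm

theorem target_init_ne_zero {x : Fin (m + 1) → E} (h : γ (m + 1) x ≠ 0) :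
    γ m (Fin.init x) ≠ 0 := by
  intro h0
  have hle := M.wgt_le_of_pos m h1 hm x ((M.pos_div_norm (by omega) hm).2 h)
  rw [wgt, h0, zero_mul, ENNReal.div_zero h, top_le_iff] at hle
  exact M.bound_ne_top _ (by omega) hm hle

theorem wgt_le (x : Fin (m + 1) → E) : wgt γ q m x ≤ B (m + 1) := by
  by_cases h : γ (m + 1) x = 0
  · simp [wgt, h]
  · exact M.wgt_le_of_pos m h1 hm x ((M.pos_div_norm (by omega) hm).2 h)

theorem measurable_wgt : Measurable (wgt γ q m) := by
  have hi : Measurable fun x : Fin (m + 1) → E => (Fin.init x : Fin m → E) :=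
    measurable_pi_lambda _ fun i => measurable_pi_apply _
  exact (M.measurable_target _ (by omega) hm).div
    (((M.measurable_target m h1 (by omega)).comp hi).mul
      ((M.measurable_step m h1 hm).comp (hi.prodMk (measurable_pi_apply _))))

theorem mul_wgt_snoc {z : Fin m → E} (hz : γ m z ≠ 0) (y : E) :
    q m z y * wgt γ q m (Fin.snoc z y) = γ (m + 1) (Fin.snoc z y) / γ m z := by
  rw [wgt, Fin.init_snoc, Fin.snoc_last, div_eq_mul_inv, ENNReal.mul_inv (Or.inl hz)
    (Or.inl (M.target_ne_top m h1 (by omega) z)), div_eq_mul_inv]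
  calc _ = γ (m + 1) (Fin.snoc z y) * (γ m z)⁻¹ * (q m z y * (q m z y)⁻¹) := by ring
    _ = _ := by rw [ENNReal.mul_inv_cancel (M.step_pos m z y).ne' (M.step_ne_top m z y), mul_one]

theorem lintegral_wgt_stepKernel [SigmaFinite dx] {z : Fin m → E} (hz : γ m z ≠ 0) :
    ∫⁻ x, wgt γ q m x ∂stepKernel dx q m (M.measurable_step m h1 hm) z =
      Z (m + 1) / Z m * ratio dx γ Z m z := by
  have hZ := (M.norm_pos (m + 1) (by omega) hm).ne'
  have hZt := M.norm_ne_top (m + 1) (by omega) hm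
  have hZ' := (M.norm_pos m h1 (by omega)).ne'
  have hZt' := M.norm_ne_top m h1 (by omega)
  have hγ := M.target_ne_top m h1 (by omega) z
  have hs : Measurable fun y : E => γ (m + 1) (Fin.snoc z y) :=
    (M.measurable_target (m + 1) (by omega) hm).comp
      ((measurable_snoc m).comp measurable_prodMk_left)
  rw [lintegral_stepKernel _ z (M.measurable_wgt h1 hm)]
  simp only [M.mul_wgt_snoc h1 hm hz, div_eq_mul_inv]
  rw [lintegral_mul_const _ hs, ratio, marg, div_eq_mul_inv, div_eq_mul_inv, div_eq_mul_inv,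
    ENNReal.mul_inv (Or.inl hz) (Or.inl hγ), inv_inv]
  calc _ = (∫⁻ y, γ (m + 1) (Fin.snoc z y) ∂dx) * (γ m z)⁻¹ * (Z (m + 1) * (Z (m + 1))⁻¹) *
        (Z m * (Z m)⁻¹) := by
        rw [ENNReal.mul_inv_cancel hZ hZt, ENNReal.mul_inv_cancel hZ' hZt', mul_one, mul_one]
    _ = _ := by ring

theorem lintegral_tgt_stepKernel [SigmaFinite dx]
    {F : (Fin (m + 1) → E) → ℝ≥0∞} (hF : Measurable F) :
    ∫⁻ z, ∫⁻ x, wgt γ q m x * F x ∂stepKernel dx q m (M.measurable_step m h1 hm) z ∂tgt dx γ Z m =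
      (Z m)⁻¹ * ∫⁻ x, γ (m + 1) x * F x ∂(Measure.pi fun _ : Fin (m + 1) => dx) := by
  have hγ' : Measurable fun x => γ (m + 1) x * F x :=
    (M.measurable_target (m + 1) (by omega) hm).mul hF
  have hγm := M.measurable_target m h1 (by omega)
  have hwF : Measurable fun x => wgt γ q m x * F x := (M.measurable_wgt h1 hm).mul hF
  have hInt : Measurable fun p : (Fin m → E) × E =>
      γ (m + 1) (Fin.snoc p.1 p.2) * F (Fin.snoc p.1 p.2) := hγ'.comp (measurable_snoc m)
  rw [lintegral_pi_snoc dx m hγ', ← lintegral_const_mul _ hInt.lintegral_prod_right', tgt,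
    lintegral_withDensity_eq_lintegral_mul _ (hγm.div_const _) hwF.lintegral_kernel]
  refine lintegral_congr fun z => ?_
  have hs : Measurable fun y : E => γ (m + 1) (Fin.snoc z y) * F (Fin.snoc z y) :=
    hInt.comp measurable_prodMk_left
  rw [Pi.mul_apply, lintegral_stepKernel _ z hwF]
  by_cases hz : γ m z = 0
  · have h0 : ∀ y, γ (m + 1) (Fin.snoc z y) = 0 := fun y => by
      by_contra h
      exact M.target_init_ne_zero h1 hm h (by rwa [Fin.init_snoc])
    simp [hz, h0]
  · have e : ∀ y, q m z y * (wgt γ q m (Fin.snoc z y) * F (Fin.snoc z y)) =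
        (γ m z)⁻¹ * (γ (m + 1) (Fin.snoc z y) * F (Fin.snoc z y)) := fun y => by
      rw [← mul_assoc, M.mul_wgt_snoc h1 hm hz, div_eq_mul_inv]
      ring
    simp only [e]
    rw [lintegral_const_mul _ hs, div_eq_mul_inv, mul_comm (γ m z), mul_assoc,
      ← mul_assoc (γ m z), ENNReal.mul_inv_cancel hz (M.target_ne_top m h1 (by omega) z), one_mul]

theorem withDensity_wgt [SigmaFinite dx] (b : ℝ≥0∞) :
    ((tgt dx γ Z m).bind (stepKernel dx q m (M.measurable_step m h1 hm))).withDensity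
      (fun x => wgt γ q m x / b) = (Z (m + 1) / Z m / b) • tgt dx γ Z (m + 1) := by
  ext s hs
  have hi : Measurable (s.indicator (1 : (Fin (m + 1) → E) → ℝ≥0∞)) := measurable_one.indicator hs
  have hγ := M.measurable_target (m + 1) (by omega) hm
  have h := M.lintegral_tgt_stepKernel h1 hm hi
  have hwi : Measurable fun x => wgt γ q m x * s.indicator 1 x := (M.measurable_wgt h1 hm).mul hi
  have e : ∀ g : (Fin (m + 1) → E) → ℝ≥0∞, (fun x => g x * s.indicator 1 x) = s.indicator g := by
    intro g
    ext x
    by_cases hx : x ∈ s <;> simp [hx]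
  rw [← Measure.lintegral_bind (Kernel.aemeasurable _) hwi.aemeasurable, e,
    e, lintegral_indicator hs, lintegral_indicator hs] at h
  have ht : tgt dx γ Z (m + 1) s = ∫⁻ x in s, γ (m + 1) x / Z (m + 1)
      ∂(Measure.pi fun _ : Fin (m + 1) => dx) := withDensity_apply _ hs
  rw [withDensity_apply _ hs, Measure.smul_apply, ht, smul_eq_mul]
  simp only [div_eq_mul_inv]
  rw [lintegral_mul_const _ (M.measurable_wgt h1 hm), h, lintegral_mul_const _ hγ]
  calc _ = (Z m)⁻¹ * b⁻¹ * (∫⁻ x in s, γ (m + 1) x ∂(Measure.pi fun _ : Fin (m + 1) => dx)) *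
        (Z (m + 1) * (Z (m + 1))⁻¹) := by
        rw [ENNReal.mul_inv_cancel (M.norm_pos _ (by omega) hm).ne'
          (M.norm_ne_top _ (by omega) hm), mul_one]
        ring
    _ = _ := by ring

end IsModel

section PastStar

variable {Ω : Type*} {X Xs : (n : ℕ) → ℕ → Ω → (Fin n → E)} {n : ℕ}

theorem measurable_chain_pastStar {k i j : ℕ}
    (h : (1 ≤ k ∧ k ≤ P ∧ j < i) ∨ (1 ≤ k ∧ k < n ∧ j = i)) :
    Measurable[pastStar P X Xs n i] (X k j) := by
  refine measurable_iff_comap_le.2 (le_trans ?_ le_sup_left)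
  exact le_iSup_of_le k (le_iSup_of_le j (le_iSup_of_le h le_rfl))

theorem measurable_candidate_pastStar {k i j : ℕ}
    (h : (1 ≤ k ∧ k ≤ P ∧ 1 ≤ j ∧ j < i) ∨ (1 ≤ k ∧ k < n ∧ j = i)) :
    Measurable[pastStar P X Xs n i] (Xs k j) := by
  refine measurable_iff_comap_le.2 (le_trans ?_ le_sup_right)
  exact le_iSup_of_le k (le_iSup_of_le j (le_iSup_of_le h le_rfl))

theorem pastStar_le_succ (hn : n ≤ P) {i : ℕ} (hi : 1 ≤ i) :
    pastStar P X Xs n i ≤ pastStar P X Xs n (i + 1) := by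
  refine sup_le (iSup_le fun k => iSup_le fun j => iSup_le fun h => ?_)
    (iSup_le fun k => iSup_le fun j => iSup_le fun h => ?_)
  · exact (measurable_chain_pastStar (by omega)).comap_le
  · exact (measurable_candidate_pastStar (by omega)).comap_le

theorem pastStar_le [mΩ : MeasurableSpace Ω] (hX : ∀ k i, 1 ≤ k → k ≤ P → Measurable (X k i))
    (hXs : ∀ k i, 1 ≤ k → k ≤ P → Measurable (Xs k i)) (hn : n ≤ P) (i : ℕ) :
    pastStar P X Xs n i ≤ mΩ := by
  refine sup_le (iSup_le fun k => iSup_le fun j => iSup_le fun h => ?_)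
    (iSup_le fun k => iSup_le fun j => iSup_le fun h => ?_)
  · exact (hX k j (by omega) (by omega)).comap_le
  · exact (hXs k j (by omega) (by omega)).comap_le

end PastStar

section Dynamics

variable {Ω : Type*} [MeasurableSpace Ω]

variable (dx P γ Z q1 q) in
/-- The sequentially interacting chains `X` with candidates `Xs` started from `x0`. -/
structure IsInteractingChain (μ : Measure Ω) (X Xs : (n : ℕ) → ℕ → Ω → (Fin n → E))
    (x0 : (n : ℕ) → Fin n → E) : Prop where
  measurable_chain : ∀ k i, 1 ≤ k → k ≤ P → Measurable (X k i)
  measurable_candidate : ∀ k i, 1 ≤ k → k ≤ P → Measurable (Xs k i)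
  init_pos : ∀ k, 1 ≤ k → k ≤ P → 0 < γ k (x0 k) / Z k
  chain_zero : ∀ k, 1 ≤ k → k ≤ P → ∀ ω, X k 0 ω = x0 k
  candidate_one : ∀ i, 1 ≤ i → ∀ g : (Fin 1 → E) → ℝ, Measurable g → (∀ z, |g z| ≤ 1) →
    (μ[(fun ω => g (Xs 1 i ω))|pastStar P X Xs 1 i]) =ᵐ[μ] fun _ => ∫ z, g z ∂(prop1 dx q1)
  chain_one : ∀ i, 1 ≤ i → ∀ g : (Fin 1 → E) → ℝ, Measurable g → (∀ z, |g z| ≤ 1) →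
    (μ[(fun ω => g (X 1 i ω))|
        pastStar P X Xs 1 i ⊔ MeasurableSpace.comap (Xs 1 i) inferInstance]) =ᵐ[μ]
      fun ω => (acc (wgt1 γ q1) (X 1 (i - 1) ω) (Xs 1 i ω)).toReal * g (Xs 1 i ω) +
        (1 - (acc (wgt1 γ q1) (X 1 (i - 1) ω) (Xs 1 i ω)).toReal) * g (X 1 (i - 1) ω)
  candidate_succ : ∀ m, 1 ≤ m → m + 1 ≤ P → ∀ i, 1 ≤ i → ∀ g : (Fin (m + 1) → E) → ℝ,
    Measurable g → (∀ z, |g z| ≤ 1) →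
    (μ[(fun ω => g (Xs (m + 1) i ω))|pastStar P X Xs (m + 1) i]) =ᵐ[μ]
      fun ω => ∫ z, g z ∂(propM dx q m (emp X m i ω))
  chain_succ : ∀ m, 1 ≤ m → m + 1 ≤ P → ∀ i, 1 ≤ i → ∀ g : (Fin (m + 1) → E) → ℝ,
    Measurable g → (∀ z, |g z| ≤ 1) →
    (μ[(fun ω => g (X (m + 1) i ω))|
        pastStar P X Xs (m + 1) i ⊔ MeasurableSpace.comap (Xs (m + 1) i) inferInstance]) =ᵐ[μ]
      fun ω => (acc (wgt γ q m) (X (m + 1) (i - 1) ω) (Xs (m + 1) i ω)).toReal *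
          g (Xs (m + 1) i ω) +
        (1 - (acc (wgt γ q m) (X (m + 1) (i - 1) ω) (Xs (m + 1) i ω)).toReal) *
          g (X (m + 1) (i - 1) ω)

/-- A chain never enters a set which it does not charge initially and in which candidates are
always rejected. -/
theorem IsAdaptiveChain.ae_mem {G : Type*} [MeasurableSpace G] {μ : Measure Ω}
    [IsProbabilityMeasure μ] {𝓕 : ℕ → MeasurableSpace Ω} {a : G → G → ℝ} {v : G → ℝ}
    {N : ℕ → Ω → ProbMeas G} {X V : ℕ → Ω → G} {ε : ℝ} (h : IsAdaptiveChain μ 𝓕 a v N X V ε)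
    {S : Set G} (hS : MeasurableSet S) (h0 : ∀ᵐ ω ∂μ, X 0 ω ∈ S)
    (ha : ∀ x y, y ∉ S → a x y = 0) (k : ℕ) : ∀ᵐ ω ∂μ, X k ω ∈ S := by
  induction k with
  | zero => exact h0
  | succ k ih =>
    have hg : Measurable (Sᶜ.indicator (1 : G → ℝ)) := measurable_one.indicator hS.compl
    have hg0 : ∀ x, 0 ≤ Sᶜ.indicator (1 : G → ℝ) x :=
      fun x => Set.indicator_nonneg (fun _ _ => zero_le_one) x
    have hg1 : ∀ x, |Sᶜ.indicator (1 : G → ℝ) x| ≤ 1 := fun x => by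
      rw [abs_of_nonneg (hg0 x)]
      exact Set.indicator_le_self' (fun _ _ => zero_le_one) x
    have hle := sup_le (h.le k) (h.measurable_V k).comap_le
    have hz : μ[fun ω => Sᶜ.indicator (1 : G → ℝ) (X (k + 1) ω)|
        𝓕 k ⊔ MeasurableSpace.comap (V k) inferInstance] =ᵐ[μ] 0 := by
      filter_upwards [h.condExp_chain k _ hg hg1, ih] with ω hω hX
      rw [hω]
      by_cases hV : V k ω ∈ S
      · simp [hV, hX]
      · simp [hX, ha _ _ hV]
    have hi := integral_condExp hle (f := fun ω => Sᶜ.indicator (1 : G → ℝ) (X (k + 1) ω)) (μ := μ)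
    rw [integral_congr_ae hz] at hi
    have h1 := (integral_eq_zero_iff_of_nonneg (fun ω => hg0 _)
      (integrable_of_abs_le (hg.comp (h.measurable_X (k + 1))) fun ω => hg1 _)).1
      (by simpa using hi.symm)
    filter_upwards [h1] with ω hω
    by_contra hX
    simp [hX] at hω

variable {μ : Measure Ω} [IsProbabilityMeasure μ] {X Xs : (n : ℕ) → ℕ → Ω → (Fin n → E)}
  {x0 : (n : ℕ) → Fin n → E}

namespace IsModel

variable (M : IsModel dx P γ Z q1 q B)

include M

theorem bound_one_ne_zero [SigmaFinite dx] : B 1 ≠ 0 := by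
  intro h
  have h0 : ∀ x, wgt1 γ q1 x = 0 := fun x => le_antisymm (h ▸ M.wgt1_le x) zero_le
  have := M.lintegral_prop1_withDensity (F := fun _ => 1) measurable_const
  simp only [mul_one, ← M.norm_eq 1 le_rfl M.one_le, h0, lintegral_zero] at this
  exact (M.norm_pos 1 le_rfl M.one_le).ne this

theorem integral_weight_mul_prop1 [SigmaFinite dx] (f : (Fin 1 → E) → ℝ) :
    ∫ x, (wgt1 γ q1 x / B 1).toReal * f x ∂prop1 dx q1 =
      (Z 1 / B 1).toReal * ∫ x, f x ∂tgt dx γ Z 1 :=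
  integral_weight_mul M.measurable_wgt1 M.bound_one_ne_zero (M.bound_ne_top 1 le_rfl M.one_le)
    M.wgt1_le (M.withDensity_wgt1 _) f

theorem integral_weight_prop1 [SigmaFinite dx] :
    ∫ x, (wgt1 γ q1 x / B 1).toReal ∂prop1 dx q1 = (Z 1 / B 1).toReal := by
  have := M.isProbabilityMeasure_tgt le_rfl M.one_le
  simpa using M.integral_weight_mul_prop1 fun _ => 1

theorem isAcceptance_one : IsAcceptance (fun x y => (acc (wgt1 γ q1) x y).toReal)
    fun x => (wgt1 γ q1 x / B 1).toReal :=
  isAcceptance_acc M.measurable_wgt1 (M.bound_ne_top 1 le_rfl M.one_le) M.wgt1_le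

omit [IsProbabilityMeasure μ] in
theorem isAdaptiveChain_one [SigmaFinite dx]
    (S : IsInteractingChain dx P γ Z q1 q μ X Xs x0) :
    IsAdaptiveChain μ (fun k => pastStar P X Xs 1 (k + 1))
      (fun x y => (acc (wgt1 γ q1) x y).toReal) (fun x => (wgt1 γ q1 x / B 1).toReal)
      (fun _ _ => ⟨prop1 dx q1, M.isProbabilityMeasure_prop1⟩) (X 1) (fun k => Xs 1 (k + 1))
      (Z 1 / B 1).toReal where
  le k := pastStar_le S.measurable_chain S.measurable_candidate M.one_le _
  mono := monotone_nat_of_le_succ fun k => pastStar_le_succ M.one_le (by omega)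
  measurable_proposal k := measurable_const
  measurable_chain k := measurable_chain_pastStar (Or.inl ⟨le_rfl, M.one_le, by omega⟩)
  measurable_candidate k :=
    measurable_candidate_pastStar (Or.inl ⟨le_rfl, M.one_le, by omega, by omega⟩)
  condExp_candidate k g hg hg1 := S.candidate_one (k + 1) (by omega) g hg hg1
  condExp_chain k g hg hg1 := S.chain_one (k + 1) (by omega) g hg hg1
  pos := ENNReal.toReal_pos
    (ENNReal.div_pos (M.norm_pos 1 le_rfl M.one_le).ne' (M.bound_ne_top 1 le_rfl M.one_le)).ne'
    (ENNReal.div_lt_top (M.norm_ne_top 1 le_rfl M.one_le) M.bound_one_ne_zero).ne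
  minor k := Filter.Eventually.of_forall fun ω => M.integral_weight_prop1.ge
  slow k ω g _ _ := by
    rw [sub_self, abs_zero]
    positivity

variable {m : ℕ} (h1 : 1 ≤ m) (hm : m + 1 ≤ P)

include h1 hm

theorem bound_succ_ne_zero [SigmaFinite dx] : B (m + 1) ≠ 0 := by
  intro h
  have h0 : ∀ x, wgt γ q m x = 0 := fun x => le_antisymm (h ▸ M.wgt_le h1 hm x) zero_le
  have := M.lintegral_tgt_stepKernel h1 hm (F := fun _ => 1) measurable_const
  simp only [mul_one, ← M.norm_eq (m + 1) (by omega) hm, h0, lintegral_zero] at this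
  exact mul_ne_zero (ENNReal.inv_ne_zero.2 (M.norm_ne_top m h1 (by omega)))
    (M.norm_pos _ (by omega) hm).ne' this.symm

theorem isAcceptance_succ : IsAcceptance (fun x y => (acc (wgt γ q m) x y).toReal)
    fun x => (wgt γ q m x / B (m + 1)).toReal :=
  isAcceptance_acc (M.measurable_wgt h1 hm) (M.bound_ne_top _ (by omega) hm) (M.wgt_le h1 hm)

theorem isProbabilityMeasure_propM [SigmaFinite dx] (ν : Measure (Fin m → E))
    [IsProbabilityMeasure ν] : IsProbabilityMeasure (propM dx q m ν) := by
  refine ⟨?_⟩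
  rw [← lintegral_one, lintegral_propM (M.measurable_step m h1 hm) _ measurable_const]
  simp [M.lintegral_step m h1 hm]

theorem integral_integral_weight_mul [SigmaFinite dx] {f : (Fin (m + 1) → E) → ℝ}
    (hf : Measurable f) (hf1 : ∀ x, |f x| ≤ 1) :
    ∫ z, ∫ x, (wgt γ q m x / B (m + 1)).toReal * f x
      ∂stepKernel dx q m (M.measurable_step m h1 hm) z ∂tgt dx γ Z m =
      (Z (m + 1) / Z m / B (m + 1)).toReal * ∫ x, f x ∂tgt dx γ Z (m + 1) := by
  have := M.isProbabilityMeasure_tgt h1 (by omega)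
  have A := M.isAcceptance_succ h1 hm
  rw [← integral_weight_mul (M.measurable_wgt h1 hm) (M.bound_succ_ne_zero h1 hm)
    (M.bound_ne_top _ (by omega) hm) (M.wgt_le h1 hm) (M.withDensity_wgt h1 hm _) f,
    ← propM_eq_bind]
  exact (integral_propM (M.measurable_step m h1 hm) (M.lintegral_step m h1 hm) _
    (A.measurable_weight.mul hf) (A.abs_weight_mul_le hf1)).symm

theorem le_integral_weight_stepKernel [SigmaFinite dx] {δ : ℝ≥0∞} {z : Fin m → E}
    (hz : γ m z ≠ 0) (hδ : δ ≤ ratio dx γ Z m z) :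
    (Z (m + 1) / Z m * δ / B (m + 1)).toReal ≤
      ∫ x, (wgt γ q m x / B (m + 1)).toReal ∂stepKernel dx q m (M.measurable_step m h1 hm) z := by
  have := isMarkovKernel_stepKernel (M.measurable_step m h1 hm) (M.lintegral_step m h1 hm)
  have hle : ∀ x, wgt γ q m x / B (m + 1) ≤ 1 := fun x =>
    (ENNReal.div_le_div_right (M.wgt_le h1 hm x) _).trans ENNReal.div_self_le_one
  have hm' := (M.measurable_wgt h1 hm).div_const (B (m + 1))
  rw [integral_toReal hm'.aemeasurable
    (Filter.Eventually.of_forall fun x => (hle x).trans_lt ENNReal.one_lt_top)]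
  refine ENNReal.toReal_mono (ne_top_of_le_ne_top ENNReal.one_ne_top
    ((lintegral_mono hle).trans (by simp))) ?_
  simp only [div_eq_mul_inv (wgt γ q m _)]
  rw [lintegral_mul_const _ (M.measurable_wgt h1 hm), M.lintegral_wgt_stepKernel h1 hm hz,
    div_eq_mul_inv]
  gcongr

theorem exists_isAdaptiveChain_succ [SigmaFinite dx] : ∃ ε : ℝ, 0 < ε ∧
    ∀ (Ω : Type*) [MeasurableSpace Ω] (μ : Measure Ω) [IsProbabilityMeasure μ]
      (X Xs : (n : ℕ) → ℕ → Ω → (Fin n → E)) (x0 : (n : ℕ) → Fin n → E),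
      IsInteractingChain dx P γ Z q1 q μ X Xs x0 →
      (∀ k, ∀ᵐ ω ∂μ, γ m (X m k ω) ≠ 0) →
      IsAdaptiveChain μ (fun k => pastStar P X Xs (m + 1) (k + 1))
        (fun x y => (acc (wgt γ q m) x y).toReal) (fun x => (wgt γ q m x / B (m + 1)).toReal)
        (fun k ω => ⟨propM dx q m (emp X m (k + 1) ω), M.isProbabilityMeasure_propM h1 hm _⟩)
        (X (m + 1)) (fun k => Xs (m + 1) (k + 1)) ε := by
  obtain ⟨δ, hδ, hδr⟩ := M.le_ratio m h1 hm
  have hq := M.measurable_step m h1 hm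
  have hd := M.lintegral_step m h1 hm
  have hκ := isMarkovKernel_stepKernel hq hd
  have A := M.isAcceptance_succ h1 hm
  have hpos : 0 < (Z (m + 1) / Z m * min δ 1 / B (m + 1)).toReal := by
    have hB := M.bound_ne_top _ (by omega) hm
    have hB0 := M.bound_succ_ne_zero h1 hm
    have hZ := (M.norm_pos (m + 1) (by omega) hm).ne'
    have hZt := M.norm_ne_top (m + 1) (by omega) hm
    have hZ' := (M.norm_pos m h1 (by omega)).ne'
    have hZt' := M.norm_ne_top m h1 (by omega)
    have hδ1 : min δ 1 ≠ ⊤ := ne_top_of_le_ne_top ENNReal.one_ne_top (min_le_right _ _)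
    have hδ0 : min δ 1 ≠ 0 := (lt_min hδ one_pos).ne'
    refine ENNReal.toReal_pos (ENNReal.div_pos (mul_ne_zero (ENNReal.div_pos hZ hZt').ne' hδ0)
      hB).ne' (ENNReal.div_lt_top (ENNReal.mul_ne_top (ENNReal.div_lt_top hZt hZ').ne hδ1) hB0).ne
  refine ⟨_, hpos, fun Ω _ μ _ X Xs x0 S hsupp => ?_⟩
  have hInt : ∀ (i : ℕ) ω (g : (Fin (m + 1) → E) → ℝ), Measurable g → (∀ z, |g z| ≤ 1) →
      ∫ x, g x ∂propM dx q m (emp X m i ω) =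
        ∫ z, ∫ x, g x ∂stepKernel dx q m hq z ∂emp X m i ω :=
    fun i ω g hg hg1 => integral_propM hq hd _ hg hg1
  have hmeas : ∀ g : (Fin (m + 1) → E) → ℝ, Measurable g →
      Measurable fun z => ∫ x, g x ∂stepKernel dx q m hq z :=
    fun g hg => (hg.stronglyMeasurable.comp_measurable
      measurable_snd).integral_kernel_prod_right'.measurable
  exact
  { le := fun k => pastStar_le S.measurable_chain S.measurable_candidate hm _
    mono := monotone_nat_of_le_succ fun k => pastStar_le_succ hm (by omega)
    measurable_proposal := fun k => by
      refine Measurable.subtype_mk ?_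
      have e : (fun ω => propM dx q m (emp X m (k + 1) ω)) =
          fun ω => (emp X m (k + 1) ω).bind (stepKernel dx q m hq) :=
        funext fun ω => propM_eq_bind hq _
      rw [e]
      exact (Measure.measurable_bind' (Kernel.measurable _)).comp
        (measurable_emp X m (k + 1) fun j hj => measurable_chain_pastStar (by omega))
    measurable_chain := fun k => measurable_chain_pastStar (by omega)
    measurable_candidate := fun k => measurable_candidate_pastStar (by omega)
    condExp_candidate := fun k => S.candidate_succ m h1 hm (k + 1) (by omega)
    condExp_chain := fun k => S.chain_succ m h1 hm (k + 1) (by omega)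
    pos := hpos
    minor := fun k => by
      filter_upwards [ae_all_iff.2 hsupp] with ω hω
      have hφ := fun j => M.le_integral_weight_stepKernel h1 hm (hω j)
        ((min_le_left δ 1).trans (hδr _ ((M.pos_div_norm h1 (by omega)).2 (hω j))))
      rw [hInt _ _ _ A.measurable_weight A.abs_weight_le_one,
        integral_emp X m (k + 1) ω (hmeas _ A.measurable_weight)
          (fun z => abs_integral_le A.abs_weight_le_one)]
      have hs := Finset.card_nsmul_le_sum (Finset.range (k + 1 + 1)) _ _ fun j _ => hφ j
      rw [Finset.card_range, nsmul_eq_mul] at hs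
      rw [inv_mul_eq_div, le_div_iff₀ (by positivity), mul_comm]
      exact_mod_cast hs
    slow := fun k ω g hg hg1 => by
      show |∫ y, g y ∂propM dx q m (emp X m (k + 1 + 1) ω) -
        ∫ y, g y ∂propM dx q m (emp X m (k + 1) ω)| ≤ _
      rw [hInt _ _ g hg hg1, hInt _ _ g hg hg1]
      refine (abs_integral_emp_succ_sub_le X m (k + 1) ω (hmeas g hg)
        (fun z => abs_integral_le hg1)).trans ?_
      push_cast
      gcongr
      linarith }

omit [IsProbabilityMeasure μ] in
/-- A law of large numbers at one level yields one for the proposals of the next level. -/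
theorem eLpNorm_integral_propM_sub_le [SigmaFinite dx] {p K : ℝ} (hK : 0 ≤ K)
    (hX : ∀ g : (Fin m → E) → ℝ, Measurable g → (∀ z, |g z| ≤ 1) → ∀ i : ℕ, 1 ≤ i →
      eLpNorm (fun ω => ∑ j ∈ Finset.range i, (g (X m j ω) - ∫ z, g z ∂tgt dx γ Z m))
        (ENNReal.ofReal p) μ ≤ ENNReal.ofReal (K * √(i : ℝ)))
    {f : (Fin (m + 1) → E) → ℝ} (hf : Measurable f) (hf1 : ∀ x, |f x| ≤ 1) (k : ℕ) :
    eLpNorm (fun ω => ∫ x, (wgt γ q m x / B (m + 1)).toReal * f x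
        ∂propM dx q m (emp X m (k + 1) ω) -
        (Z (m + 1) / Z m / B (m + 1)).toReal * ∫ x, f x ∂tgt dx γ Z (m + 1))
      (ENNReal.ofReal p) μ ≤ ENNReal.ofReal (K / √((k : ℝ) + 1)) := by
  have hq := M.measurable_step m h1 hm
  have hd := M.lintegral_step m h1 hm
  have hκ := isMarkovKernel_stepKernel hq hd
  have A := M.isAcceptance_succ h1 hm
  have hvf := A.measurable_weight.mul hf
  have hφ : Measurable fun z => ∫ x, (wgt γ q m x / B (m + 1)).toReal * f x
      ∂stepKernel dx q m hq z :=
    (hvf.stronglyMeasurable.comp_measurable measurable_snd).integral_kernel_prod_right'.measurable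
  have hφ1 : ∀ z, |∫ x, (wgt γ q m x / B (m + 1)).toReal * f x ∂stepKernel dx q m hq z| ≤ 1 :=
    fun z => abs_integral_le (A.abs_weight_mul_le hf1)
  have e : (fun ω => ∫ x, (wgt γ q m x / B (m + 1)).toReal * f x
        ∂propM dx q m (emp X m (k + 1) ω) -
        (Z (m + 1) / Z m / B (m + 1)).toReal * ∫ x, f x ∂tgt dx γ Z (m + 1)) =
      ((k : ℝ) + 2)⁻¹ • fun ω => ∑ j ∈ Finset.range (k + 2),
        (∫ x, (wgt γ q m x / B (m + 1)).toReal * f x ∂stepKernel dx q m hq (X m j ω) -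
          ∫ z, ∫ x, (wgt γ q m x / B (m + 1)).toReal * f x ∂stepKernel dx q m hq z
            ∂tgt dx γ Z m) := by
    ext ω
    have hInt := integral_propM hq hd (emp X m (k + 1) ω) hvf (A.abs_weight_mul_le hf1)
    have hemp := integral_emp X m (k + 1) ω hφ hφ1
    simp only [Pi.mul_apply] at hInt
    rw [hInt, hemp, M.integral_integral_weight_mul h1 hm hf hf1, Pi.smul_apply, smul_eq_mul,
      Finset.sum_sub_distrib, Finset.sum_const, Finset.card_range, nsmul_eq_mul]
    have hk : (k : ℝ) + 2 ≠ 0 := by positivity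
    push_cast
    field_simp
    ring
  rw [e, eLpNorm_const_smul, Real.enorm_eq_ofReal (by positivity)]
  refine (mul_le_mul_right (hX _ hφ hφ1 (k + 2) (by omega)) _).trans ?_
  rw [← ENNReal.ofReal_mul (by positivity)]
  refine ENNReal.ofReal_le_ofReal ?_
  push_cast
  have hk : (0 : ℝ) < k + 2 := by positivity
  have hs : 0 < √((k : ℝ) + 2) := Real.sqrt_pos.2 hk
  calc ((k : ℝ) + 2)⁻¹ * (K * √((k : ℝ) + 2)) = K / √((k : ℝ) + 2) := by
        rw [inv_mul_eq_div, div_eq_div_iff hk.ne' hs.ne', mul_assoc, Real.mul_self_sqrt hk.le]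
    _ ≤ K / √((k : ℝ) + 1) := by gcongr; linarith

end IsModel

theorem integral_rpow_le_of_eLpNorm_le {F : Ω → ℝ} (hF : Measurable F) {c : ℝ}
    (hc : ∀ ω, |F ω| ≤ c) {p : ℝ} (hp : 1 ≤ p) {C : ℝ} (hC : 0 ≤ C)
    (h : eLpNorm F (ENNReal.ofReal p) μ ≤ ENNReal.ofReal C) :
    (∫ ω, |F ω| ^ p ∂μ) ^ (1 / p) ≤ C := by
  have hp0 : 0 < p := by linarith
  have hm : MemLp F (ENNReal.ofReal p) μ :=
    MemLp.of_bound hF.aestronglyMeasurable c (Filter.Eventually.of_forall hc)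
  rw [hm.eLpNorm_eq_integral_rpow_norm (by simpa using hp0) ENNReal.ofReal_ne_top,
    ENNReal.toReal_ofReal hp0.le, ENNReal.ofReal_le_ofReal_iff hC] at h
  simpa using h

/-- A moment bound for centered sums of rescaled weights gives one for averages of weights. -/
theorem integral_average_rpow_le {G : Type*} [MeasurableSpace G] {w : G → ℝ≥0∞} {b r : ℝ≥0∞}
    (A : IsAcceptance (fun x y => (acc w x y).toReal) fun x => (w x / b).toReal)
    (hb0 : b ≠ 0) (hb : b ≠ ⊤) {V : ℕ → Ω → G} (hV : ∀ k, 1 ≤ k → Measurable (V k)) {p : ℝ}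
    (hp : 1 ≤ p) {C : ℝ} (hC : 0 ≤ C) {i : ℕ} (hi : 1 ≤ i)
    (h : eLpNorm (fun ω => ∑ k ∈ Finset.range i, ((w (V (k + 1) ω) / b).toReal - (r / b).toReal))
      (ENNReal.ofReal p) μ ≤ ENNReal.ofReal (C * √(i : ℝ))) :
    (∫ ω, |(i : ℝ)⁻¹ * (∑ k ∈ Finset.Icc 1 i, (w (V k ω)).toReal) - r.toReal| ^ p ∂μ) ^ (1 / p) ≤
      b.toReal * C / (i : ℝ) ^ ((1 : ℝ) / 2) := by
  have hi0 : (0 : ℝ) < i := by exact_mod_cast hi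
  have hbr : 0 < b.toReal := ENNReal.toReal_pos hb0 hb
  have e : (fun ω => (i : ℝ)⁻¹ * (∑ k ∈ Finset.Icc 1 i, (w (V k ω)).toReal) - r.toReal) =
      (b.toReal * (i : ℝ)⁻¹) • fun ω =>
        ∑ k ∈ Finset.range i, ((w (V (k + 1) ω) / b).toReal - (r / b).toReal) := by
    ext ω
    have hr : Finset.Icc 1 i = (Finset.range i).map (addRightEmbedding 1) := by
      ext k
      simp only [Finset.mem_Icc, Finset.mem_map, Finset.mem_range, addRightEmbedding_apply]
      exact ⟨fun hk => ⟨k - 1, by omega, by omega⟩, by rintro ⟨j, hj, rfl⟩; omega⟩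
    simp only [hr, Finset.sum_map, addRightEmbedding_apply, Pi.smul_apply, smul_eq_mul,
      ENNReal.toReal_div, Finset.sum_sub_distrib, Finset.sum_const, Finset.card_range,
      nsmul_eq_mul, ← Finset.sum_div]
    field_simp
  have hle : eLpNorm
      (fun ω => (i : ℝ)⁻¹ * (∑ k ∈ Finset.Icc 1 i, (w (V k ω)).toReal) - r.toReal)
      (ENNReal.ofReal p) μ ≤ ENNReal.ofReal (b.toReal * C / (i : ℝ) ^ ((1 : ℝ) / 2)) := by
    rw [e, eLpNorm_const_smul, Real.enorm_eq_ofReal (by positivity)]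
    refine (mul_le_mul_right h _).trans ?_
    rw [← ENNReal.ofReal_mul (by positivity), ← Real.sqrt_eq_rpow]
    refine ENNReal.ofReal_le_ofReal (le_of_eq ?_)
    have hs : √(i : ℝ) * √(i : ℝ) = i := Real.mul_self_sqrt hi0.le
    have hs0 : 0 < √(i : ℝ) := Real.sqrt_pos.2 hi0
    rw [eq_div_iff hs0.ne']
    calc _ = b.toReal * C * ((i : ℝ)⁻¹ * (√(i : ℝ) * √(i : ℝ))) := by ring
      _ = _ := by rw [hs, inv_mul_cancel₀ hi0.ne', mul_one]
  have hF : Measurable fun ω =>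
      ∑ k ∈ Finset.range i, ((w (V (k + 1) ω) / b).toReal - (r / b).toReal) :=
    Finset.measurable_sum _ fun k _ =>
      (A.measurable_weight.comp (hV (k + 1) (by omega))).sub_const _
  refine integral_rpow_le_of_eLpNorm_le (c := b.toReal * (i : ℝ)⁻¹ * (i * (1 + (r / b).toReal)))
    (by rw [e]; exact hF.const_smul _) (fun ω => ?_) hp (by positivity) hle
  rw [congrFun e ω, Pi.smul_apply, smul_eq_mul, abs_mul, abs_of_pos (by positivity)]
  refine mul_le_mul_of_nonneg_left ((Finset.abs_sum_le_sum_abs _ _).trans ?_) (by positivity)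
  refine (Finset.sum_le_card_nsmul _ _ (1 + (r / b).toReal) fun k _ => ?_).trans
    (le_of_eq (by rw [Finset.card_range, nsmul_eq_mul]))
  refine (abs_sub _ _).trans (add_le_add (A.abs_weight_le_one _) ?_)
  rw [abs_of_nonneg ENNReal.toReal_nonneg]

namespace IsModel

variable [SigmaFinite dx] (M : IsModel dx P γ Z q1 q B)

include M

/-- The chains stay in the supports of the targets, and their averages converge at rate
`1 / √i`. -/
theorem exists_eLpNorm_sum_sub_le {n : ℕ} (h1 : 1 ≤ n) (hn : n ≤ P) :
    ∃ K : ℝ → ℝ, (∀ p, 0 ≤ K p) ∧ ∀ p : ℝ, 1 ≤ p →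
      ∀ (Ω : Type*) [MeasurableSpace Ω] (μ : Measure Ω) [IsProbabilityMeasure μ]
        (X Xs : (n : ℕ) → ℕ → Ω → (Fin n → E)) (x0 : (n : ℕ) → Fin n → E),
        IsInteractingChain dx P γ Z q1 q μ X Xs x0 →
        (∀ k, ∀ᵐ ω ∂μ, γ n (X n k ω) ≠ 0) ∧
        ∀ g : (Fin n → E) → ℝ, Measurable g → (∀ z, |g z| ≤ 1) → ∀ i : ℕ, 1 ≤ i →
          eLpNorm (fun ω => ∑ j ∈ Finset.range i, (g (X n j ω) - ∫ z, g z ∂tgt dx γ Z n))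
            (ENNReal.ofReal p) μ ≤ ENNReal.ofReal (K p * √(i : ℝ)) := by
  induction n, h1 using Nat.le_induction with
  | base =>
    have hε : 0 < (Z 1 / B 1).toReal := ENNReal.toReal_pos
      (ENNReal.div_pos (M.norm_pos 1 le_rfl hn).ne' (M.bound_ne_top 1 le_rfl hn)).ne'
      (ENNReal.div_lt_top (M.norm_ne_top 1 le_rfl hn) M.bound_one_ne_zero).ne
    have hT := M.isProbabilityMeasure_tgt le_rfl hn
    refine ⟨chainConst (Z 1 / B 1).toReal 0, fun p => chainConst_nonneg hε le_rfl,
      fun p hp Ω _ μ _ X Xs x0 S => ⟨fun k => ?_, fun g hg hg1 i hi => ?_⟩⟩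
    · refine (M.isAdaptiveChain_one S).ae_mem (S := {x | γ 1 x ≠ 0})
        (M.measurable_target 1 le_rfl hn (measurableSet_singleton 0).compl) ?_ (fun x y hy => ?_) k
      · refine Filter.Eventually.of_forall fun ω => ?_
        rw [S.chain_zero 1 le_rfl hn]
        exact (M.pos_div_norm le_rfl hn).1 (S.init_pos 1 le_rfl hn)
      · have hy0 : γ 1 y = 0 := by simpa using hy
        simp [acc, wgt1, hy0]
    · refine (M.isAdaptiveChain_one S).eLpNorm_sum_sub_le M.isAcceptance_one hg hg1
        (L := (Z 1 / B 1).toReal) (abs_integral_le hg1) hp le_rfl (fun k => ?_) (fun k => ?_) hi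
      · simp [M.integral_weight_mul_prop1, -ENNReal.toReal_div]
      · simp [M.integral_weight_prop1, -ENNReal.toReal_div]
  | succ m h1 ih =>
    obtain ⟨K, hK, hKX⟩ := ih (by omega)
    obtain ⟨ε, hε, hchain⟩ := M.exists_isAdaptiveChain_succ h1 hn
    have hT := M.isProbabilityMeasure_tgt (n := m + 1) (by omega) hn
    have A := M.isAcceptance_succ h1 hn
    refine ⟨fun p => chainConst ε (K p) p, fun p => chainConst_nonneg hε (hK p),
      fun p hp Ω _ μ _ X Xs x0 S => ?_⟩
    obtain ⟨hsupp, hX⟩ := hKX p hp Ω μ X Xs x0 S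
    have hc := hchain Ω μ X Xs x0 S hsupp
    refine ⟨fun k => ?_, fun g hg hg1 i hi => ?_⟩
    · refine hc.ae_mem (S := {x | γ (m + 1) x ≠ 0})
        (M.measurable_target _ (by omega) hn (measurableSet_singleton 0).compl) ?_
        (fun x y hy => ?_) k
      · refine Filter.Eventually.of_forall fun ω => ?_
        rw [S.chain_zero _ (by omega) hn]
        exact (M.pos_div_norm (by omega) hn).1 (S.init_pos _ (by omega) hn)
      · have hy0 : γ (m + 1) y = 0 := by simpa using hy
        simp [acc, wgt, hy0]
    · refine hc.eLpNorm_sum_sub_le A hg hg1 (L := (Z (m + 1) / Z m / B (m + 1)).toReal)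
        (abs_integral_le hg1) hp (hK p)
        (M.eLpNorm_integral_propM_sub_le h1 hn (hK p) hX hg hg1) (fun k => ?_) hi
      simpa using M.eLpNorm_integral_propM_sub_le h1 hn (hK p) hX (f := fun _ => 1)
        measurable_const (fun _ => by simp) k

end IsModel

end Dynamics

end Assumptions

end Model

theorem statement18
    (dx : Measure E) [SigmaFinite dx] (P : ℕ) (hP : 1 ≤ P)
    (γ : (n : ℕ) → (Fin n → E) → ℝ≥0∞)
    (hγ : ∀ n, 1 ≤ n → n ≤ P → Measurable (γ n))
    (hγfin : ∀ n, 1 ≤ n → n ≤ P → ∀ x, γ n x ≠ ⊤)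
    (Z : ℕ → ℝ≥0∞)
    (hZ : ∀ n, 1 ≤ n → n ≤ P → Z n = ∫⁻ x, γ n x ∂(Measure.pi fun _ : Fin n => dx))
    (hZ0 : ∀ n, 1 ≤ n → n ≤ P → 0 < Z n) (hZt : ∀ n, 1 ≤ n → n ≤ P → Z n ≠ ⊤)
    (q1 : E → ℝ≥0∞) (hq1 : Measurable q1) (hq1pos : ∀ y, 0 < q1 y)
    (hq1fin : ∀ y, q1 y ≠ ⊤) (hq1dens : ∫⁻ y, q1 y ∂dx = 1)
    (q : (m : ℕ) → (Fin m → E) → E → ℝ≥0∞)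
    (hq : ∀ m, 1 ≤ m → m + 1 ≤ P → Measurable fun p : (Fin m → E) × E => q m p.1 p.2)
    (hqpos : ∀ m x y, 0 < q m x y) (hqfin : ∀ m x y, q m x y ≠ ⊤)
    (hqdens : ∀ m, 1 ≤ m → m + 1 ≤ P → ∀ x, ∫⁻ y, q m x y ∂dx = 1)
    (B : ℕ → ℝ≥0∞) (hBt : ∀ n, 1 ≤ n → n ≤ P → B n ≠ ⊤)
    (hA11 : ∀ x : Fin 1 → E, 0 < γ 1 x / Z 1 → wgt1 γ q1 x ≤ B 1)
    (hA1 : ∀ m, 1 ≤ m → m + 1 ≤ P → ∀ x : Fin (m + 1) → E,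
      0 < γ (m + 1) x / Z (m + 1) → wgt γ q m x ≤ B (m + 1))
    (hδ : ∀ m, 1 ≤ m → m + 1 ≤ P → ∃ δ : ℝ≥0∞, 0 < δ ∧
      ∀ x : Fin m → E, 0 < γ m x / Z m → δ ≤ ratio dx γ Z m x)
    :
    ∃ C1 : ℕ → ℝ, ∃ C2 : ℝ → ℝ,
      ∀ p : ℝ, 1 ≤ p →
      ∀ (Ω : Type*) [MeasurableSpace Ω] (μ : Measure Ω) [IsProbabilityMeasure μ]
        (X Xs : (n : ℕ) → ℕ → Ω → (Fin n → E)) (x0 : (n : ℕ) → Fin n → E),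
        (∀ k i, 1 ≤ k → k ≤ P → Measurable (X k i)) →
        (∀ k i, 1 ≤ k → k ≤ P → Measurable (Xs k i)) →
        (∀ k, 1 ≤ k → k ≤ P → 0 < γ k (x0 k) / Z k) →
        (∀ k, 1 ≤ k → k ≤ P → ∀ ω, X k 0 ω = x0 k) →
        (∀ i, 1 ≤ i → ∀ g : (Fin 1 → E) → ℝ, Measurable g → (∀ z, |g z| ≤ 1) →
          (μ[(fun ω => g (Xs 1 i ω))|pastStar P X Xs 1 i]) =ᵐ[μ]
            fun _ => ∫ z, g z ∂(prop1 dx q1)) →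
        (∀ i, 1 ≤ i → ∀ g : (Fin 1 → E) → ℝ, Measurable g → (∀ z, |g z| ≤ 1) →
          (μ[(fun ω => g (X 1 i ω))|
              pastStar P X Xs 1 i ⊔ MeasurableSpace.comap (Xs 1 i) inferInstance]) =ᵐ[μ]
            fun ω => (acc (wgt1 γ q1) (X 1 (i - 1) ω) (Xs 1 i ω)).toReal * g (Xs 1 i ω) +
              (1 - (acc (wgt1 γ q1) (X 1 (i - 1) ω) (Xs 1 i ω)).toReal) *
                g (X 1 (i - 1) ω)) →
        (∀ m, 1 ≤ m → m + 1 ≤ P → ∀ i, 1 ≤ i → ∀ g : (Fin (m + 1) → E) → ℝ,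
          Measurable g → (∀ z, |g z| ≤ 1) →
          (μ[(fun ω => g (Xs (m + 1) i ω))|pastStar P X Xs (m + 1) i]) =ᵐ[μ]
            fun ω => ∫ z, g z ∂(propM dx q m (emp X m i ω))) →
        (∀ m, 1 ≤ m → m + 1 ≤ P → ∀ i, 1 ≤ i → ∀ g : (Fin (m + 1) → E) → ℝ,
          Measurable g → (∀ z, |g z| ≤ 1) →
          (μ[(fun ω => g (X (m + 1) i ω))|
              pastStar P X Xs (m + 1) i ⊔
                MeasurableSpace.comap (Xs (m + 1) i) inferInstance]) =ᵐ[μ]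
            fun ω =>
              (acc (wgt γ q m) (X (m + 1) (i - 1) ω) (Xs (m + 1) i ω)).toReal *
                  g (Xs (m + 1) i ω) +
                (1 - (acc (wgt γ q m) (X (m + 1) (i - 1) ω) (Xs (m + 1) i ω)).toReal) *
                  g (X (m + 1) (i - 1) ω)) →
        ∀ i : ℕ, 1 ≤ i →
          ((∫ ω, |(i : ℝ)⁻¹ * (∑ k ∈ Finset.Icc 1 i, (wgt1 γ q1 (Xs 1 k ω)).toReal) -
              (Z 1).toReal| ^ p ∂μ) ^ (1 / p) ≤
            (B 1).toReal * C1 1 * C2 p / (i : ℝ) ^ ((1 : ℝ) / 2)) ∧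
          ∀ m, 1 ≤ m → m + 1 ≤ P →
            (∫ ω, |(i : ℝ)⁻¹ *
                (∑ k ∈ Finset.Icc 1 i, (wgt γ q m (Xs (m + 1) k ω)).toReal) -
                (Z (m + 1) / Z m).toReal| ^ p ∂μ) ^ (1 / p) ≤
              (B (m + 1)).toReal * C1 (m + 1) * C2 p / (i : ℝ) ^ ((1 : ℝ) / 2) := by
  have M : IsModel dx P γ Z q1 q B :=
    ⟨hP, hγ, hγfin, hZ, hZ0, hZt, hq1, hq1pos, hq1fin, hq1dens, hq, hqpos, hqfin, hqdens, hBt, hA11,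
      hA1, hδ⟩
  have hex : ∀ m, ∃ K : ℝ → ℝ, (∀ p, 0 ≤ K p) ∧ (1 ≤ m → m + 1 ≤ P → ∀ p : ℝ, 1 ≤ p →
      ∀ (Ω : Type _) [MeasurableSpace Ω] (μ : Measure Ω) [IsProbabilityMeasure μ]
        (X Xs : (n : ℕ) → ℕ → Ω → (Fin n → E)) (x0 : (n : ℕ) → Fin n → E),
        IsInteractingChain dx P γ Z q1 q μ X Xs x0 →
        (∀ k, ∀ᵐ ω ∂μ, γ m (X m k ω) ≠ 0) ∧
        ∀ g : (Fin m → E) → ℝ, Measurable g → (∀ z, |g z| ≤ 1) → ∀ i : ℕ, 1 ≤ i →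
          eLpNorm (fun ω => ∑ j ∈ Finset.range i, (g (X m j ω) - ∫ z, g z ∂tgt dx γ Z m))
            (ENNReal.ofReal p) μ ≤ ENNReal.ofReal (K p * √(i : ℝ))) := fun m => by
    by_cases h : 1 ≤ m ∧ m + 1 ≤ P
    · obtain ⟨K, hK, hKX⟩ := M.exists_eLpNorm_sum_sub_le h.1 (by omega : m ≤ P)
      exact ⟨K, hK, fun _ _ => hKX⟩
    · exact ⟨0, fun _ => le_rfl, fun h1 hm => absurd ⟨h1, hm⟩ h⟩
  choose K hK hKX using hex
  have hKs : ∀ p, 0 ≤ ∑ m ∈ Finset.range P, 2 * K m p :=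
    fun p => Finset.sum_nonneg fun m _ => by have := hK m p; positivity
  have hmom := momentConst_nonneg
  refine ⟨fun _ => 1, fun p => 2 * momentConst p + ∑ m ∈ Finset.range P, 2 * K m p, ?_⟩
  intro p hp Ω _ μ _ X Xs x0 hX hXs hx0 hX0 hc1 hx1 hcs hxs i hi
  have S : IsInteractingChain dx P γ Z q1 q μ X Xs x0 :=
    ⟨hX, hXs, hx0, hX0, hc1, hx1, hcs, hxs⟩
  have hC : 0 ≤ 2 * momentConst p + ∑ m ∈ Finset.range P, 2 * K m p := by
    have := hKs p; have := hmom p; positivity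
  simp only [mul_one]
  constructor
  · have A := M.isAcceptance_one
    refine integral_average_rpow_le A M.bound_one_ne_zero (hBt 1 le_rfl hP)
      (fun k _ => hXs 1 k le_rfl hP) hp hC hi ?_
    refine ((M.isAdaptiveChain_one S).eLpNorm_weight_average_le A hp le_rfl (fun k => ?_)
      i).trans (ENNReal.ofReal_le_ofReal ?_)
    · simp [M.integral_weight_prop1, -ENNReal.toReal_div]
    · have := hKs p
      gcongr
      linarith
  · intro m h1 hm
    have A := M.isAcceptance_succ h1 hm
    obtain ⟨hsupp, hlln⟩ := hKX m h1 hm p hp Ω μ X Xs x0 S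
    obtain ⟨ε, -, hchain⟩ := M.exists_isAdaptiveChain_succ h1 hm
    refine integral_average_rpow_le A (M.bound_succ_ne_zero h1 hm) (hBt _ (by omega) hm)
      (fun k _ => hXs _ k (by omega) hm) hp hC hi ?_
    refine ((hchain Ω μ X Xs x0 S hsupp).eLpNorm_weight_average_le A hp (hK m p) (fun k => ?_)
      i).trans (ENNReal.ofReal_le_ofReal ?_)
    · have := M.isProbabilityMeasure_tgt (n := m + 1) (by omega) hm
      simpa using M.eLpNorm_integral_propM_sub_le h1 hm (hK m p) hlln (f := fun _ => 1)
        measurable_const (fun _ => by simp) k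
    · have := Finset.single_le_sum (f := fun m => 2 * K m p)
        (fun j _ => by have := hK j p; positivity) (Finset.mem_range.2 (by omega : m < P))
      gcongr

end

end Paper
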